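/- arXiv:math/0105180 — 3 statements merged into one kernel-verified Lean document; each statement's English description precedes it below -/
import Mathlib

section
/- Let n ≥ 4 and consider the 2n−2 points ±e_j ∈ ℝ^n for j = 2,…,n (the vertices of a crosspolytope in the hyperplane x_1 = 0). If r is a real number with √(1 − 1/(n−1)) < r < 1, then the set of one-dimensional affine subspaces ℓ of ℝ^n whose Euclidean distance from each of these 2n−2 points equals r has exactly 2^n elements. -/
open scoped RealInnerProductSpace

/-- The squared distance from a point `c` to the line through `p` with direction `v`. -/
lemma infDist_mk'_span_singleton_sq {E : Type*} [NormedAddCommGroup E] [InnerProductSpace ℝ E]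
    (c p v : E) (hv : v ≠ 0) :
    Metric.infDist c (AffineSubspace.mk' p (ℝ ∙ v) : Set E) ^ 2 =
      ‖c - p‖ ^ 2 - ⟪v, c - p⟫ ^ 2 / ‖v‖ ^ 2 := by
  have hv2 : 0 < ‖v‖ ^ 2 := by positivity
  have key : ∀ s : ℝ, dist c (p + s • v) ^ 2 =
      ‖c - p‖ ^ 2 - 2 * s * ⟪v, c - p⟫ + s ^ 2 * ‖v‖ ^ 2 := by
    intro s
    rw [dist_eq_norm, ← sub_sub, norm_sub_sq_real, inner_smul_right, norm_smul,
      real_inner_comm, mul_pow, Real.norm_eq_abs, sq_abs]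
    ring
  have foot : dist c (p + (⟪v, c - p⟫ / ‖v‖ ^ 2) • v) ^ 2 =
      ‖c - p‖ ^ 2 - ⟪v, c - p⟫ ^ 2 / ‖v‖ ^ 2 := by
    rw [key]
    field_simp
    ring
  have mem : ∀ s : ℝ, p + s • v ∈ AffineSubspace.mk' p (ℝ ∙ v) := by
    intro s
    rw [AffineSubspace.mem_mk', vsub_eq_sub, add_sub_cancel_left]
    exact Submodule.smul_mem _ _ (Submodule.mem_span_singleton_self v)
  rw [← foot]
  congr 1
  refine le_antisymm (Metric.infDist_le_dist_of_mem (mem _)) ?_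
  rw [Metric.le_infDist ⟨_, mem 0⟩]
  intro y hy
  obtain ⟨s, hs⟩ := Submodule.mem_span_singleton.1 ((AffineSubspace.mem_mk').1 hy)
  obtain rfl : y = p + s • v := by rw [hs, vsub_eq_sub, add_sub_cancel]
  refine le_of_sq_le_sq ?_ dist_nonneg
  rw [foot, key, ← sub_nonneg]
  have : ‖c - p‖ ^ 2 - 2 * s * ⟪v, c - p⟫ + s ^ 2 * ‖v‖ ^ 2 -
      (‖c - p‖ ^ 2 - ⟪v, c - p⟫ ^ 2 / ‖v‖ ^ 2) =
      (s * ‖v‖ ^ 2 - ⟪v, c - p⟫) ^ 2 / ‖v‖ ^ 2 := by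
    field_simp
    ring
  rw [this]
  positivity

/-- The line through `p` with direction `v ⟂ p` is at distance `r` from both `eⱼ` and `-eⱼ` iff
`pⱼ = 0` and `1 + ‖p‖² - vⱼ² / ‖v‖² = r²`. -/
lemma infDist_single_eq_and_neg_iff {ι : Type*} [Fintype ι] [DecidableEq ι]
    {p v : EuclideanSpace ℝ ι} (hv : v ≠ 0) (hpv : ⟪v, p⟫ = 0) {r : ℝ} (hr : 0 ≤ r) (j : ι) :
    (Metric.infDist (EuclideanSpace.single j (1 : ℝ))
        (AffineSubspace.mk' p (ℝ ∙ v) : Set (EuclideanSpace ℝ ι)) = r ∧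
      Metric.infDist (-EuclideanSpace.single j (1 : ℝ))
        (AffineSubspace.mk' p (ℝ ∙ v) : Set (EuclideanSpace ℝ ι)) = r) ↔
      p j = 0 ∧ 1 + ‖p‖ ^ 2 - v j ^ 2 / ‖v‖ ^ 2 = r ^ 2 := by
  have e1 : ⟪EuclideanSpace.single j (1 : ℝ), p⟫ = p j := by
    simp [EuclideanSpace.inner_single_left]
  have e2 : ⟪v, EuclideanSpace.single j (1 : ℝ)⟫ = v j := by
    simp [EuclideanSpace.inner_single_right]
  have e3 : ‖EuclideanSpace.single j (1 : ℝ)‖ = 1 := by simp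
  rw [← sq_eq_sq₀ Metric.infDist_nonneg hr, ← sq_eq_sq₀ Metric.infDist_nonneg hr,
    infDist_mk'_span_singleton_sq _ _ _ hv, infDist_mk'_span_singleton_sq _ _ _ hv,
    norm_sub_sq_real, norm_sub_sq_real, inner_sub_right, inner_sub_right, inner_neg_left,
    inner_neg_right, norm_neg, hpv, e1, e2, e3]
  constructor
  · rintro ⟨h1, h2⟩
    have : p j = 0 := by
      norm_num at h1 h2
      linarith
    refine ⟨this, ?_⟩
    rw [this] at h1
    norm_num at h1
    linarith
  · rintro ⟨h1, h2⟩
    rw [h1]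
    norm_num
    linarith

/-- Every line has the form `p + ℝ v` with `v ≠ 0` and `v ⟂ p`. -/
lemma exists_eq_mk'_span_singleton_of_finrank_eq_one {E : Type*} [NormedAddCommGroup E]
    [InnerProductSpace ℝ E] (l : AffineSubspace ℝ E) (h : Module.finrank ℝ l.direction = 1) :
    ∃ p v : E, v ≠ 0 ∧ ⟪v, p⟫ = 0 ∧ l = AffineSubspace.mk' p (ℝ ∙ v) := by
  obtain ⟨⟨v, hvl⟩, hv0, hv⟩ := finrank_eq_one_iff'.1 h
  have hv0' : v ≠ 0 := fun h0 => hv0 (Subtype.ext h0)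
  have hdir : l.direction = ℝ ∙ v := by
    refine le_antisymm (fun w hw => ?_) (by simpa using hvl)
    obtain ⟨c, hc⟩ := hv ⟨w, hw⟩
    exact Submodule.mem_span_singleton.2 ⟨c, congrArg Subtype.val hc⟩
  have hne : (l : Set E).Nonempty := by
    rw [AffineSubspace.nonempty_iff_ne_bot]
    rintro rfl
    rw [AffineSubspace.direction_bot, finrank_bot] at h
    exact zero_ne_one h
  obtain ⟨q, hq⟩ := hne
  have hv2 : ‖v‖ ^ 2 ≠ 0 := by positivity
  have hp : q - (⟪v, q⟫ / ‖v‖ ^ 2) • v ∈ l := by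
    have := AffineSubspace.vadd_mem_of_mem_direction
      (Submodule.smul_mem _ (-(⟪v, q⟫ / ‖v‖ ^ 2)) hvl) hq
    rwa [vadd_eq_add, neg_smul, neg_add_eq_sub] at this
  refine ⟨q - (⟪v, q⟫ / ‖v‖ ^ 2) • v, v, hv0', ?_, ?_⟩
  · rw [inner_sub_right, inner_smul_right, real_inner_self_eq_norm_sq]
    field_simp
    ring
  · rw [← hdir, AffineSubspace.mk'_eq hp]

/-- A line is determined by a direction with `j`-th coordinate `1` and a point with `j`-th
coordinate `0`. -/
lemma mk'_span_singleton_inj {ι : Type*} {p p' v v' : EuclideanSpace ℝ ι} {j : ι}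
    (hp : p j = 0) (hp' : p' j = 0) (hv : v j = 1) (hv' : v' j = 1)
    (h : AffineSubspace.mk' p (ℝ ∙ v) = AffineSubspace.mk' p' (ℝ ∙ v')) : p = p' ∧ v = v' := by
  constructor
  · have hm : p ∈ AffineSubspace.mk' p' (ℝ ∙ v') := h ▸ AffineSubspace.self_mem_mk' p _
    obtain ⟨s, hs⟩ := Submodule.mem_span_singleton.1 ((AffineSubspace.mem_mk').1 hm)
    have hj := congrArg (fun x => x j) hs
    simp only [PiLp.smul_apply, vsub_eq_sub, PiLp.sub_apply, hp, hp', hv', smul_eq_mul] at hj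
    obtain rfl : s = 0 := by linarith
    rw [zero_smul, vsub_eq_sub] at hs
    exact sub_eq_zero.1 hs.symm
  · have hd := congrArg AffineSubspace.direction h
    rw [AffineSubspace.direction_mk', AffineSubspace.direction_mk'] at hd
    obtain ⟨s, hs⟩ := Submodule.mem_span_singleton.1 (hd ▸ Submodule.mem_span_singleton_self v)
    have hj := congrArg (fun x => x j) hs
    simp only [PiLp.smul_apply, hv, hv', smul_eq_mul, mul_one] at hj
    rw [← hs, hj, one_smul]

namespace Crosspolytope

/-- The sign encoded by a Boolean. -/
def sgn (b : Bool) : ℝ := if b then 1 else -1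

lemma sgn_sq (b : Bool) : sgn b ^ 2 = 1 := by cases b <;> simp [sgn]

lemma sgn_injective : Function.Injective sgn := by
  intro a b h
  cases a <;> cases b <;> first | rfl | norm_num [sgn] at h

lemma sgn_ne_zero (b : Bool) : sgn b ≠ 0 := by cases b <;> simp [sgn]

lemma exists_eq_sgn_mul {x y : ℝ} (h : x ^ 2 = y ^ 2) : ∃ b, x = sgn b * y := by
  rcases sq_eq_sq_iff_eq_or_eq_neg.1 h with h | h
  · exact ⟨true, by simp [sgn, h]⟩
  · exact ⟨false, by simp [sgn, h]⟩

variable {k : ℕ}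

/-- The direction with first coordinate `a`, last coordinate `1` and remaining coordinates `±1`. -/
noncomputable def dir (a : ℝ) (σ : Fin (k + 2) → Bool) : EuclideanSpace ℝ (Fin (k + 2)) :=
  WithLp.toLp 2 fun j => if j = 0 then a else if j = Fin.last (k + 1) then 1 else sgn (σ j)

@[simp] lemma dir_zero (a : ℝ) (σ : Fin (k + 2) → Bool) : dir a σ 0 = a := by simp [dir]

@[simp] lemma dir_last (a : ℝ) (σ : Fin (k + 2) → Bool) : dir a σ (Fin.last (k + 1)) = 1 := by
  simp [dir]

lemma dir_ne_zero (a : ℝ) (σ : Fin (k + 2) → Bool) : dir a σ ≠ 0 := by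
  intro h
  have := congrArg (fun x => x (Fin.last (k + 1))) h
  simp at this

lemma dir_of_ne (a : ℝ) (σ : Fin (k + 2) → Bool) {j : Fin (k + 2)} (h0 : j ≠ 0)
    (hl : j ≠ Fin.last (k + 1)) : dir a σ j = sgn (σ j) := by simp [dir, h0, hl]

lemma dir_sq (a : ℝ) (σ : Fin (k + 2) → Bool) {j : Fin (k + 2)} (h0 : j ≠ 0) :
    dir a σ j ^ 2 = 1 := by
  by_cases hl : j = Fin.last (k + 1)
  · simp [hl]
  · rw [dir_of_ne a σ h0 hl, sgn_sq]

lemma norm_sq_of_sq_eq_one {v : EuclideanSpace ℝ (Fin (k + 2))} (h : ∀ j ≠ 0, v j ^ 2 = 1) :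
    ‖v‖ ^ 2 = v 0 ^ 2 + (k + 1) := by
  rw [EuclideanSpace.norm_sq_eq, Fin.sum_univ_succ]
  simp [h]

/-- The candidate common tangents: the last Boolean selects between lines through the origin and
lines orthogonal to the first axis, the others are signs. -/
noncomputable def tangentLine (B Q : ℝ) (σ : Fin (k + 2) → Bool) :
    AffineSubspace ℝ (EuclideanSpace ℝ (Fin (k + 2))) :=
  AffineSubspace.mk'
    (EuclideanSpace.single 0 (if σ (Fin.last (k + 1)) then 0 else sgn (σ 0) * Q))
    (ℝ ∙ dir (if σ (Fin.last (k + 1)) then sgn (σ 0) * B else 0) σ)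

lemma tangentLine_injective {B Q : ℝ} (hB : B ≠ 0) (hQ : Q ≠ 0) :
    Function.Injective (tangentLine (k := k) B Q) := by
  intro σ τ h
  obtain ⟨hp, hv⟩ := mk'_span_singleton_inj (j := Fin.last (k + 1)) (by simp) (by simp)
    (by simp) (by simp) h
  have hp0 := congrArg (fun x => x 0) hp
  have hv0 := congrArg (fun x => x 0) hv
  simp only [dir_zero, PiLp.single_apply, if_true] at hp0 hv0
  have hσ := sgn_ne_zero (σ 0)
  have hτ := sgn_ne_zero (τ 0)
  have key : σ (Fin.last (k + 1)) = τ (Fin.last (k + 1)) ∧ sgn (σ 0) = sgn (τ 0) := by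
    cases h1 : σ (Fin.last (k + 1)) <;> cases h2 : τ (Fin.last (k + 1)) <;>
      simp_all
  funext j
  by_cases hl : j = Fin.last (k + 1)
  · rw [hl, key.1]
  by_cases h0 : j = 0
  · rw [h0, sgn_injective key.2]
  · have := congrArg (fun x => x j) hv
    simp only [dir_of_ne _ _ h0 hl] at this
    exact sgn_injective this

/-- A line at distance `r` from all the points `±eⱼ`, `j ≠ 0`. -/
def IsCommonTangent (r : ℝ) (l : AffineSubspace ℝ (EuclideanSpace ℝ (Fin (k + 2)))) : Prop :=
  Module.finrank ℝ l.direction = 1 ∧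
    ∀ j : Fin (k + 2), 1 ≤ j.val →
      Metric.infDist (EuclideanSpace.single j (1 : ℝ))
          (l : Set (EuclideanSpace ℝ (Fin (k + 2)))) = r ∧
      Metric.infDist (-EuclideanSpace.single j (1 : ℝ))
          (l : Set (EuclideanSpace ℝ (Fin (k + 2)))) = r

lemma one_le_val_iff {j : Fin (k + 2)} : 1 ≤ j.val ↔ j ≠ 0 := by
  rw [Nat.one_le_iff_ne_zero, ne_eq, ne_eq, Fin.ext_iff, Fin.val_zero]

lemma isCommonTangent_tangentLine {B Q r : ℝ} (hr : 0 ≤ r)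
    (hB : B ^ 2 = 1 / (1 - r ^ 2) - (k + 1)) (hQ : Q ^ 2 = 1 / ((k : ℝ) + 1) - (1 - r ^ 2))
    (σ : Fin (k + 2) → Bool) : IsCommonTangent r (tangentLine B Q σ) := by
  refine ⟨?_, fun j hj => ?_⟩
  · rw [tangentLine, AffineSubspace.direction_mk', finrank_span_singleton (dir_ne_zero _ _)]
  have h0 := one_le_val_iff.1 hj
  refine (infDist_single_eq_and_neg_iff (dir_ne_zero _ _) ?_ hr j).2 ⟨?_, ?_⟩
  · rw [EuclideanSpace.inner_single_right, dir_zero]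
    cases σ (Fin.last (k + 1)) <;> simp
  · simp [h0]
  · have e : ∀ x : ℝ, ‖EuclideanSpace.single (0 : Fin (k + 2)) x‖ ^ 2 = x ^ 2 := by simp
    rw [norm_sq_of_sq_eq_one (fun i hi => dir_sq _ _ hi), dir_sq _ _ h0, dir_zero, e]
    cases σ (Fin.last (k + 1))
    · simp only [Bool.false_eq_true, if_false, mul_pow, sgn_sq, hQ]
      ring
    · simp [mul_pow, sgn_sq, hB]

lemma exists_eq_dir {v : EuclideanSpace ℝ (Fin (k + 2))} (hl : v (Fin.last (k + 1)) = 1)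
    (h : ∀ j ≠ 0, v j ^ 2 = 1) (b c : Bool) :
    ∃ σ : Fin (k + 2) → Bool, σ 0 = b ∧ σ (Fin.last (k + 1)) = c ∧ dir (v 0) σ = v := by
  have hs : ∀ j, ∃ s, j ≠ 0 → v j = sgn s := by
    intro j
    by_cases hj : j = 0
    · exact ⟨true, fun h => (h hj).elim⟩
    · obtain ⟨s, hs⟩ := exists_eq_sgn_mul (x := v j) (y := 1) (by rw [h j hj, one_pow])
      exact ⟨s, fun _ => by rw [hs, mul_one]⟩
  choose s hs using hs
  refine ⟨fun j => if j = 0 then b else if j = Fin.last (k + 1) then c else s j,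
    by simp, by simp, ?_⟩
  ext j
  by_cases h0 : j = 0
  · simp [h0]
  by_cases hj : j = Fin.last (k + 1)
  · simp [hj, hl]
  · rw [dir_of_ne _ _ h0 hj, if_neg h0, if_neg hj, hs j h0]

lemma IsCommonTangent.exists_eq_tangentLine {B Q r : ℝ} (hr : 0 ≤ r) (hr1 : r ^ 2 < 1)
    (hB : B ^ 2 = 1 / (1 - r ^ 2) - (k + 1)) (hQ : Q ^ 2 = 1 / ((k : ℝ) + 1) - (1 - r ^ 2))
    {l : AffineSubspace ℝ (EuclideanSpace ℝ (Fin (k + 2)))} (h : IsCommonTangent r l) :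
    ∃ σ, tangentLine B Q σ = l := by
  obtain ⟨hdim, ht⟩ := h
  obtain ⟨p, w, hw, hwp, rfl⟩ := exists_eq_mk'_span_singleton_of_finrank_eq_one l hdim
  have hl0 : Fin.last (k + 1) ≠ 0 := Fin.last_pos.ne'
  have hwl : w (Fin.last (k + 1)) ≠ 0 := by
    intro h0
    have := ((infDist_single_eq_and_neg_iff hw hwp hr _).1 (ht _ (one_le_val_iff.2 hl0))).2
    rw [h0] at this
    norm_num at this
    nlinarith [sq_nonneg ‖p‖]
  obtain ⟨v, hv⟩ : ∃ v, v = (w (Fin.last (k + 1)))⁻¹ • w := ⟨_, rfl⟩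
  have hspan : (ℝ ∙ w) = ℝ ∙ v := by
    rw [hv, Submodule.span_singleton_smul_eq (IsUnit.mk0 _ (inv_ne_zero hwl))]
  have hvl : v (Fin.last (k + 1)) = 1 := by simp [hv, hwl]
  have hvp : ⟪v, p⟫ = 0 := by rw [hv, real_inner_smul_left, hwp, mul_zero]
  have hv0 : v ≠ 0 := by
    rw [hv]
    exact smul_ne_zero (inv_ne_zero hwl) hw
  have hvn : ‖v‖ ^ 2 ≠ 0 := by positivity
  rw [hspan] at ht ⊢
  have hc : ∀ j ≠ 0, p j = 0 ∧ 1 + ‖p‖ ^ 2 - v j ^ 2 / ‖v‖ ^ 2 = r ^ 2 := fun j hj =>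
    (infDist_single_eq_and_neg_iff hv0 hvp hr j).1 (ht j (one_le_val_iff.2 hj))
  have hsq : ∀ j ≠ 0, v j ^ 2 = 1 := by
    intro j hj
    have h1 := (hc j hj).2
    have h2 := (hc _ hl0).2
    rw [hvl] at h2
    have h3 : v j ^ 2 / ‖v‖ ^ 2 = 1 ^ 2 / ‖v‖ ^ 2 := by linarith
    rw [div_left_inj' hvn] at h3
    rw [h3, one_pow]
  have hp : p = EuclideanSpace.single 0 (p 0) := by
    ext j
    by_cases hj : j = 0
    · simp [hj]
    · simp [hj, (hc j hj).1]
  have hpn : ‖p‖ ^ 2 = p 0 ^ 2 := by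
    rw [hp]
    simp
  have hm := (hc _ hl0).2
  rw [hvl, hpn, norm_sq_of_sq_eq_one hsq] at hm
  have hprod : p 0 = 0 ∨ v 0 = 0 := by
    rw [hp, EuclideanSpace.inner_single_right] at hvp
    simpa using hvp
  by_cases hp0 : p 0 = 0
  · have hv2 : v 0 ^ 2 = B ^ 2 := by
      have hpos : v 0 ^ 2 + ((k : ℝ) + 1) ≠ 0 := by positivity
      have e : 1 - r ^ 2 = 1 / (v 0 ^ 2 + ((k : ℝ) + 1)) := by
        rw [hp0] at hm
        linarith
      rw [hB, e, one_div_one_div]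
      ring
    obtain ⟨b, hb⟩ := exists_eq_sgn_mul hv2
    obtain ⟨σ, h0, h1, h2⟩ := exists_eq_dir hvl hsq b true
    refine ⟨σ, ?_⟩
    rw [tangentLine, h0, h1, if_pos rfl, if_pos rfl, ← hb, h2, ← hp0, ← hp]
  · have hv00 : v 0 = 0 := hprod.resolve_left hp0
    have hp2 : p 0 ^ 2 = Q ^ 2 := by
      rw [hv00] at hm
      rw [hQ]
      norm_num at hm ⊢
      linarith
    obtain ⟨b, hb⟩ := exists_eq_sgn_mul hp2
    obtain ⟨σ, h0, h1, h2⟩ := exists_eq_dir hvl hsq b false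
    refine ⟨σ, ?_⟩
    rw [tangentLine, h0, h1, if_neg Bool.false_ne_true, if_neg Bool.false_ne_true, ← hb,
      ← hv00, h2, ← hp]

end Crosspolytope


/-- for `n ≥ 4`, if `√(1 − 1/(n−1)) < r < 1`, then the `2n−2` spheres of
radius `r` centered at the crosspolytope vertices `±eⱼ`, `j = 2,…,n` (1-based indexing;
`1 ≤ j.val` in the 0-based indexing of `Fin n`), have exactly `2ⁿ` real common tangent
lines. -/
theorem crosspolytope_real_tangents (n : ℕ) (hn : 4 ≤ n) (r : ℝ)
    (h1 : Real.sqrt (1 - 1 / ((n : ℝ) - 1)) < r) (h2 : r < 1) :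
    (({ℓ | Module.finrank ℝ ℓ.direction = 1 ∧
        ∀ j : Fin n, 1 ≤ j.val →
          Metric.infDist (EuclideanSpace.single j (1 : ℝ))
              (ℓ : Set (EuclideanSpace ℝ (Fin n))) = r ∧
          Metric.infDist (-EuclideanSpace.single j (1 : ℝ))
              (ℓ : Set (EuclideanSpace ℝ (Fin n))) = r} :
        Set (AffineSubspace ℝ (EuclideanSpace ℝ (Fin n)))).Finite) ∧
    (({ℓ | Module.finrank ℝ ℓ.direction = 1 ∧
        ∀ j : Fin n, 1 ≤ j.val →
          Metric.infDist (EuclideanSpace.single j (1 : ℝ))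
              (ℓ : Set (EuclideanSpace ℝ (Fin n))) = r ∧
          Metric.infDist (-EuclideanSpace.single j (1 : ℝ))
              (ℓ : Set (EuclideanSpace ℝ (Fin n))) = r} :
        Set (AffineSubspace ℝ (EuclideanSpace ℝ (Fin n)))).ncard = 2 ^ n) := by
  obtain ⟨k, rfl⟩ : ∃ k, n = k + 2 := ⟨n - 2, by omega⟩
  have hr : 0 ≤ r := (Real.sqrt_nonneg _).trans h1.le
  have hk : (0 : ℝ) < k + 1 := by positivity
  have hcast : ((k + 2 : ℕ) : ℝ) - 1 = k + 1 := by
    push_cast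
    ring
  rw [hcast] at h1
  have hr2 : 1 - 1 / ((k : ℝ) + 1) < r ^ 2 := Real.lt_sq_of_sqrt_lt h1
  have hr1 : r ^ 2 < 1 := by nlinarith
  have hB : 0 < 1 / (1 - r ^ 2) - ((k : ℝ) + 1) := by
    rw [sub_pos, lt_one_div hk (by linarith)]
    linarith
  have hQ : 0 < 1 / ((k : ℝ) + 1) - (1 - r ^ 2) := by linarith
  have hinj := Crosspolytope.tangentLine_injective (k := k) (Real.sqrt_pos.2 hB).ne'
    (Real.sqrt_pos.2 hQ).ne'
  have hset : {l : AffineSubspace ℝ (EuclideanSpace ℝ (Fin (k + 2))) |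
      Crosspolytope.IsCommonTangent r l} = Set.range (Crosspolytope.tangentLine
        √(1 / (1 - r ^ 2) - ((k : ℝ) + 1)) √(1 / ((k : ℝ) + 1) - (1 - r ^ 2))) := by
    ext l
    constructor
    · exact fun h => h.exists_eq_tangentLine hr hr1 (Real.sq_sqrt hB.le) (Real.sq_sqrt hQ.le)
    · rintro ⟨σ, rfl⟩
      exact Crosspolytope.isCommonTangent_tangentLine hr (Real.sq_sqrt hB.le)
        (Real.sq_sqrt hQ.le) σ
  change Set.Finite {l | Crosspolytope.IsCommonTangent r l} ∧
    Set.ncard {l | Crosspolytope.IsCommonTangent r l} = 2 ^ (k + 2)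
  rw [hset]
  refine ⟨Set.finite_range _, ?_⟩
  rw [← Set.image_univ, Set.ncard_image_of_injective _ hinj, Set.ncard_univ]
  simp
end

section
/- Let n ≥ 4 and consider the 2n−2 points ±e_j ∈ ℝ^n for j = 2,…,n (the vertices of a crosspolytope in the hyperplane x_1 = 0). Let r > 0 be a real number with r ≠ 1 and r² ≠ 1 − 1/(n−1). Then the set of one-dimensional affine subspaces L of ℂ^n tangent to all 2n−2 spheres with these centers and common radius r (i.e. satisfying (v·(p−c))² = (v·v)·((p−c)² − r²) for some p ∈ L and nonzero direction v of L, for each center c) is finite with exactly 2^n elements. -/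
open scoped BigOperators

/-- The bilinear (conjugation-free) dot product on `ℂⁿ`. -/
noncomputable def dotc {n : ℕ} (x y : Fin n → ℂ) : ℂ := ∑ i, x i * y i

/-- A one-dimensional affine subspace `L ⊆ ℂⁿ` is tangent to the sphere with center `c`
and radius `r` when for some point `p ∈ L` and nonzero direction vector `v` of `L` one has
`(v·(p−c))² = (v·v)·((p−c)² − r²)`. -/
def IsTangentLine {n : ℕ} (L : AffineSubspace ℂ (Fin n → ℂ)) (c : Fin n → ℂ) (r : ℝ) : Prop :=
  ∃ p ∈ L, ∃ v ∈ L.direction, v ≠ 0 ∧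
    dotc v (p - c) ^ 2 = dotc v v * (dotc (p - c) (p - c) - (r : ℂ) ^ 2)

open Matrix in
lemma dotc_eq_dotProduct {n : ℕ} (x y : Fin n → ℂ) : dotc x y = x ⬝ᵥ y := rfl

/-- On a line, tangency may be tested at any point and any nonzero direction. -/
lemma isTangentLine_iff {n : ℕ} {L : AffineSubspace ℂ (Fin n → ℂ)}
    (hL : Module.finrank ℂ L.direction = 1) {p v : Fin n → ℂ} (hp : p ∈ L)
    (hv : v ∈ L.direction) (hv0 : v ≠ 0) (c : Fin n → ℂ) (r : ℝ) :
    IsTangentLine L c r ↔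
      dotc v (p - c) ^ 2 = dotc v v * (dotc (p - c) (p - c) - (r : ℂ) ^ 2) := by
  refine ⟨?_, fun h => ⟨p, hp, v, hv, hv0, h⟩⟩
  rintro ⟨q, hq, w, hw, hw0, h⟩
  have key := (finrank_eq_one_iff_of_nonzero' (⟨v, hv⟩ : L.direction)
    (by simpa [Subtype.ext_iff] using hv0)).1 hL
  obtain ⟨s, hs⟩ := key ⟨w, hw⟩
  obtain ⟨t, ht⟩ := key ⟨q - p, L.vsub_mem_direction hq hp⟩
  have hs : w = s • v := (congrArg Subtype.val hs).symm
  have ht : q - c = (p - c) + t • v := by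
    have : t • v = q - p := congrArg Subtype.val ht
    rw [this]; abel
  have hs0 : s ≠ 0 := by rintro rfl; simp [hs] at hw0
  rw [hs, ht] at h
  simp only [dotc_eq_dotProduct, smul_dotProduct, dotProduct_smul, dotProduct_add, add_dotProduct,
    smul_eq_mul, dotProduct_comm (p - c) v] at h ⊢
  apply mul_left_cancel₀ (pow_ne_zero 2 hs0)
  linear_combination h

/-- Tangency to the two unit-antipodal spheres centered at `±eⱼ`, decoupled. -/
lemma tangent_pair_iff {n : ℕ} (p v : Fin n → ℂ) (j : Fin n) (r : ℝ) :
    (dotc v (p - Pi.single j 1) ^ 2 =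
        dotc v v * (dotc (p - Pi.single j 1) (p - Pi.single j 1) - (r : ℂ) ^ 2) ∧
      dotc v (p - -Pi.single j 1) ^ 2 =
        dotc v v * (dotc (p - -Pi.single j 1) (p - -Pi.single j 1) - (r : ℂ) ^ 2)) ↔
    dotc v p * v j = dotc v v * p j ∧
      dotc v p ^ 2 + v j ^ 2 = dotc v v * (dotc p p + 1 - (r : ℂ) ^ 2) := by
  simp only [dotc_eq_dotProduct, sub_neg_eq_add, dotProduct_sub, sub_dotProduct, dotProduct_add,
    add_dotProduct, dotProduct_single, single_dotProduct, Pi.add_apply, Pi.sub_apply,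
    Pi.single_eq_same, mul_one, one_mul]
  constructor
  · rintro ⟨h₁, h₂⟩
    exact ⟨by linear_combination (h₂ - h₁) / 4, by linear_combination (h₂ + h₁) / 2⟩
  · rintro ⟨h₁, h₂⟩
    exact ⟨by linear_combination h₂ - 2 * h₁, by linear_combination h₂ + 2 * h₁⟩

lemma mem_tangents_iff {n : ℕ} {L : AffineSubspace ℂ (Fin n → ℂ)}
    (hL : Module.finrank ℂ L.direction = 1) {p v : Fin n → ℂ} (hp : p ∈ L)
    (hv : v ∈ L.direction) (hv0 : v ≠ 0) (r : ℝ) :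
    (∀ j : Fin n, 1 ≤ j.val → IsTangentLine L (Pi.single j 1 : Fin n → ℂ) r ∧
        IsTangentLine L (-(Pi.single j 1 : Fin n → ℂ)) r) ↔
    ∀ j : Fin n, 1 ≤ j.val → dotc v p * v j = dotc v v * p j ∧
      dotc v p ^ 2 + v j ^ 2 = dotc v v * (dotc p p + 1 - (r : ℂ) ^ 2) := by
  simp only [isTangentLine_iff hL hp hv hv0, tangent_pair_iff]

/-- The sign `±1` encoded by a Boolean. -/
noncomputable def boolSign (b : Bool) : ℂ := if b then 1 else -1

lemma boolSign_injective : Function.Injective boolSign := by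
  intro a b h
  cases a <;> cases b <;> norm_num [boolSign, neg_eq_iff_add_eq_zero, eq_neg_iff_add_eq_zero] at *

lemma boolSign_sq (b : Bool) : boolSign b ^ 2 = 1 := by cases b <;> simp [boolSign]

lemma boolSign_ne_zero (b : Bool) : boolSign b ≠ 0 := by cases b <;> simp [boolSign]

lemma exists_boolSign_mul {x y : ℂ} (h : x ^ 2 = y ^ 2) : ∃ b, boolSign b * y = x := by
  rcases sq_eq_sq_iff_eq_or_eq_neg.1 h with h | h
  · exact ⟨true, by simp [boolSign, h]⟩
  · exact ⟨false, by simp [boolSign, h]⟩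

/-- Direction of the common tangent encoded by the signs `σ`; the sign `σ 1` distinguishes the
tangents through the origin from those orthogonal to the first axis. -/
noncomputable def tangentDir {m : ℕ} (β : ℂ) (σ : Fin (m + 2) → Bool) : Fin (m + 2) → ℂ :=
  fun j => if j = 0 then (if σ 1 then boolSign (σ 0) * β else 0)
    else if j = 1 then 1 else boolSign (σ j)

/-- Base point of the common tangent encoded by the signs `σ`. -/
noncomputable def tangentPoint {m : ℕ} (q : ℂ) (σ : Fin (m + 2) → Bool) : Fin (m + 2) → ℂ :=
  Pi.single 0 (if σ 1 then 0 else boolSign (σ 0) * q)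

/-- The line through `p` with direction `v`. -/
noncomputable def lineThrough {n : ℕ} (p v : Fin n → ℂ) : AffineSubspace ℂ (Fin n → ℂ) :=
  AffineSubspace.mk' p (Submodule.span ℂ {v})

lemma lineThrough_eq {n : ℕ} {p v p' v' : Fin n → ℂ} {i : Fin n} (hp : p i = 0) (hp' : p' i = 0)
    (hv : v i = 1) (hv' : v' i = 1) (h : lineThrough p v = lineThrough p' v') :
    p = p' ∧ v = v' := by
  have hvm : v ∈ (lineThrough p' v').direction := by
    rw [← h]; simp [lineThrough, Submodule.mem_span_singleton_self]
  have hpm : p ∈ lineThrough p' v' := by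
    rw [← h]; simp [lineThrough]
  simp only [lineThrough, AffineSubspace.direction_mk', AffineSubspace.mem_mk',
    Submodule.mem_span_singleton, vsub_eq_sub] at hvm hpm
  obtain ⟨s, hs⟩ := hvm
  obtain ⟨t, ht⟩ := hpm
  have hs1 := congrFun hs i
  have ht0 := congrFun ht i
  simp only [Pi.smul_apply, Pi.sub_apply, smul_eq_mul, hv, hv', hp, hp', mul_one, sub_zero]
    at hs1 ht0
  subst hs1 ht0
  simp only [zero_smul, one_smul] at hs ht
  exact ⟨sub_eq_zero.1 ht.symm, hs.symm⟩

lemma tangent_param_injective {m : ℕ} {β q : ℂ} (hβ : β ≠ 0) (hq : q ≠ 0) :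
    Function.Injective fun σ : Fin (m + 2) → Bool =>
      lineThrough (tangentPoint q σ) (tangentDir β σ) := by
  intro σ τ h
  obtain ⟨hp, hv⟩ := lineThrough_eq (i := 1) (by simp [tangentPoint]) (by simp [tangentPoint])
    (by simp [tangentDir]) (by simp [tangentDir]) h
  have hp0 := congrFun hp 0
  have hv0 := congrFun hv 0
  simp only [tangentPoint, tangentDir, Pi.single_eq_same, if_true] at hp0 hv0
  have h01 : σ 0 = τ 0 ∧ σ 1 = τ 1 := by
    cases h1 : σ 1 <;> cases h2 : τ 1 <;>
      simp [h1, h2, hβ, hq, boolSign_ne_zero, boolSign_injective.eq_iff] at hp0 hv0 ⊢ <;> assumption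
  funext j
  by_cases hj0 : j = 0
  · exact hj0 ▸ h01.1
  by_cases hj1 : j = 1
  · exact hj1 ▸ h01.2
  simpa [tangentDir, hj0, hj1, boolSign_injective.eq_iff] using congrFun hv j

/-- Norm of a vector all of whose coordinates but the first square to one. -/
lemma dotc_self_of_sq_eq_one {m : ℕ} {v : Fin (m + 2) → ℂ} (h : ∀ j, j ≠ 0 → v j ^ 2 = 1) :
    dotc v v = v 0 ^ 2 + (m + 1) := by
  rw [dotc, Fin.sum_univ_succ, Finset.sum_congr rfl fun j _ =>
    show v (Fin.succ j) * v (Fin.succ j) = 1 by rw [← sq]; exact h _ (Fin.succ_ne_zero j)]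
  simp [sq]

lemma finrank_direction_lineThrough {n : ℕ} (p : Fin n → ℂ) {v : Fin n → ℂ} (hv : v ≠ 0) :
    Module.finrank ℂ (lineThrough p v).direction = 1 := by
  rw [lineThrough, AffineSubspace.direction_mk', finrank_span_singleton hv]

/-- The lines of the parametrization are common tangents. -/
lemma tangent_param_mem {m : ℕ} {β q : ℂ} {r : ℝ} (hβ : (β ^ 2 + (m + 1)) * (1 - (r : ℂ) ^ 2) = 1)
    (hq : ((m : ℂ) + 1) * (q ^ 2 + 1 - (r : ℂ) ^ 2) = 1) (σ : Fin (m + 2) → Bool) :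
    Module.finrank ℂ (lineThrough (tangentPoint q σ) (tangentDir β σ)).direction = 1 ∧
      ∀ j : Fin (m + 2), 1 ≤ j.val →
        IsTangentLine (lineThrough (tangentPoint q σ) (tangentDir β σ)) (Pi.single j 1) r ∧
        IsTangentLine (lineThrough (tangentPoint q σ) (tangentDir β σ)) (-Pi.single j 1) r := by
  have hv0 : tangentDir β σ ≠ 0 := fun h => by simpa [tangentDir] using congrFun h 1
  have hsq : ∀ j, j ≠ 0 → tangentDir β σ j ^ 2 = 1 := by
    intro j hj
    by_cases hj1 : j = 1 <;> simp [tangentDir, hj, hj1, boolSign_sq]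
  have hL := finrank_direction_lineThrough (tangentPoint q σ) hv0
  refine ⟨hL, (mem_tangents_iff hL (AffineSubspace.self_mem_mk' _ _)
    (by simp [lineThrough, Submodule.mem_span_singleton_self]) hv0 r).2 fun j hj => ?_⟩
  have hj0 : j ≠ 0 := by rintro rfl; simp at hj
  have hdot : dotc (tangentDir β σ) (tangentPoint q σ) = 0 := by
    cases h1 : σ 1 <;> simp [dotc_eq_dotProduct, tangentPoint, tangentDir, h1]
  rw [hdot, hsq j hj0, dotc_self_of_sq_eq_one hsq]
  refine ⟨by simp [tangentPoint, hj0], ?_⟩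
  cases h1 : σ 1 <;>
    simp only [dotc_eq_dotProduct, tangentPoint, tangentDir, h1, single_dotProduct,
      Pi.single_eq_same, if_true, Bool.false_eq_true, if_false]
  · linear_combination -hq -(m + 1) * q ^ 2 * boolSign_sq (σ 0)
  · linear_combination -hβ - β ^ 2 * (1 - (r : ℂ) ^ 2) * boolSign_sq (σ 0)

/-- A common tangent has a non-isotropic direction. -/
lemma dotc_self_ne_zero_of_tangent {m : ℕ} {p v : Fin (m + 2) → ℂ} {r : ℝ} (hv0 : v ≠ 0)
    (h : ∀ j : Fin (m + 2), 1 ≤ j.val → dotc v p * v j = dotc v v * p j ∧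
      dotc v p ^ 2 + v j ^ 2 = dotc v v * (dotc p p + 1 - (r : ℂ) ^ 2)) : dotc v v ≠ 0 := by
  intro h0
  have hj : ∀ j : Fin (m + 1), v j.succ = 0 := by
    intro j
    obtain ⟨h₁, h₂⟩ := h j.succ (by simp)
    rw [h0, zero_mul] at h₁ h₂
    rcases mul_eq_zero.1 h₁ with h₁ | h₁
    · simpa [h₁] using h₂
    · exact h₁
  rw [dotc, Fin.sum_univ_succ] at h0
  simp only [hj, mul_zero, Finset.sum_const_zero, add_zero, mul_self_eq_zero] at h0
  exact hv0 (funext (Fin.cases h0 hj))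

/-- Every common tangent has a normalized point and direction. -/
lemma exists_normal_form {m : ℕ} {r : ℝ} (hr : 1 - (r : ℂ) ^ 2 ≠ 0)
    {L : AffineSubspace ℂ (Fin (m + 2) → ℂ)} (hL : Module.finrank ℂ L.direction = 1)
    (h : ∀ j : Fin (m + 2), 1 ≤ j.val →
      IsTangentLine L (Pi.single j 1) r ∧ IsTangentLine L (-Pi.single j 1) r) :
    ∃ p v : Fin (m + 2) → ℂ, L = lineThrough p v ∧ (∀ j, j ≠ 0 → p j = 0) ∧ v 1 = 1 ∧
      (∀ j, j ≠ 0 → v j ^ 2 = 1) ∧ v 0 * p 0 = 0 ∧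
      (v 0 ^ 2 + (m + 1)) * (p 0 ^ 2 + 1 - (r : ℂ) ^ 2) = 1 := by
  have hne : (L : Set (Fin (m + 2) → ℂ)).Nonempty := by
    obtain ⟨p, hp, -⟩ := (h 1 (by simp)).1
    exact ⟨p, hp⟩
  obtain ⟨p₀, hp₀⟩ := hne
  obtain ⟨⟨w, hw⟩, hw0, -⟩ := finrank_eq_one_iff'.1 hL
  replace hw0 : w ≠ 0 := by simpa [Subtype.ext_iff] using hw0
  have hww := dotc_self_ne_zero_of_tangent hw0 ((mem_tangents_iff hL hp₀ hw hw0 r).1 h)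
  set p := (-(dotc w p₀ / dotc w w)) • w + p₀ with hp_def
  have hp : p ∈ L := AffineSubspace.vadd_mem_of_mem_direction (L.direction.smul_mem _ hw) hp₀
  have hwp : dotc w p = 0 := by
    have : dotc w p = -(dotc w p₀ / dotc w w) * dotc w w + dotc w p₀ := by
      simp [hp_def, dotc_eq_dotProduct, dotProduct_add]
    rw [this]; field_simp; ring
  have hT := (mem_tangents_iff hL hp hw hw0 r).1 h
  have hpj : ∀ j, j ≠ 0 → p j = 0 := by
    intro j hj
    have := (hT j (Nat.one_le_iff_ne_zero.2 (Fin.val_ne_zero_iff.2 hj))).1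
    rw [hwp, zero_mul] at this
    exact (mul_eq_zero.1 this.symm).resolve_left hww
  have hps : p = Pi.single 0 (p 0) := by
    funext j
    by_cases hj : j = 0
    · subst hj; simp
    · simp [hj, hpj j hj]
  have hpp : dotc p p = p 0 ^ 2 := by
    rw [dotc_eq_dotProduct, hps]; simp [sq]
  have hw0p : w 0 * p 0 = 0 := by
    rw [← hwp, dotc_eq_dotProduct]
    conv_rhs => rw [hps]
    simp
  have hwj : ∀ j, j ≠ 0 → w j ^ 2 = dotc w w * (p 0 ^ 2 + 1 - (r : ℂ) ^ 2) := by
    intro j hj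
    have := (hT j (Nat.one_le_iff_ne_zero.2 (Fin.val_ne_zero_iff.2 hj))).2
    rwa [hwp, hpp, zero_pow two_ne_zero, zero_add] at this
  have hw1 : w 1 ≠ 0 := by
    intro hw1
    have hz : p 0 ^ 2 + 1 - (r : ℂ) ^ 2 = 0 := by
      have := hwj 1 (by simp)
      rw [hw1, zero_pow two_ne_zero] at this
      exact (mul_eq_zero.1 this.symm).resolve_left hww
    have hwz : ∀ j, j ≠ 0 → w j = 0 := fun j hj => by simpa [hz] using hwj j hj
    have hw00 : w 0 ≠ 0 := fun h0 => hw0 <| funext fun j => by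
      by_cases hj : j = 0
      · rw [hj, h0]; rfl
      · exact hwz j hj
    have hp0 := (mul_eq_zero.1 hw0p).resolve_left hw00
    exact hr (by simpa [hp0] using hz)
  set v := (w 1)⁻¹ • w with hv_def
  have hv : v ∈ L.direction := L.direction.smul_mem _ hw
  have hv1 : v 1 = 1 := by simp [hv_def, hw1]
  have hv0 : v ≠ 0 := fun h0 => by simp [h0] at hv1
  have hvj : ∀ j, j ≠ 0 → v j ^ 2 = 1 := by
    intro j hj
    have : w j ^ 2 = w 1 ^ 2 := by rw [hwj j hj, hwj 1 (by simp)]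
    simp only [hv_def, Pi.smul_apply, smul_eq_mul, mul_pow, this]
    field_simp
  refine ⟨p, v, ?_, hpj, hv1, hvj, ?_, ?_⟩
  · have hspan : Submodule.span ℂ {v} = L.direction :=
      Submodule.eq_of_le_of_finrank_eq (by simpa using hv) (by rw [finrank_span_singleton hv0, hL])
    rw [lineThrough, hspan, AffineSubspace.mk'_eq hp]
  · simp only [hv_def, Pi.smul_apply, smul_eq_mul, mul_assoc, hw0p, mul_zero]
  · have hT1 := ((mem_tangents_iff hL hp hv hv0 r).1 h 1 (by simp)).2
    have hvp : dotc v p = 0 := by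
      have : dotc v p = (w 1)⁻¹ * dotc w p := by simp [hv_def, dotc_eq_dotProduct]
      rw [this, hwp, mul_zero]
    rw [hvp, hv1, hpp, dotc_self_of_sq_eq_one hvj] at hT1
    linear_combination -hT1

/-- Every common tangent occurs in the parametrization. -/
lemma exists_tangent_param {m : ℕ} {β q : ℂ} {r : ℝ}
    (hβ : (β ^ 2 + (m + 1)) * (1 - (r : ℂ) ^ 2) = 1)
    (hq : ((m : ℂ) + 1) * (q ^ 2 + 1 - (r : ℂ) ^ 2) = 1)
    {L : AffineSubspace ℂ (Fin (m + 2) → ℂ)} (hL : Module.finrank ℂ L.direction = 1)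
    (h : ∀ j : Fin (m + 2), 1 ≤ j.val →
      IsTangentLine L (Pi.single j 1) r ∧ IsTangentLine L (-Pi.single j 1) r) :
    ∃ σ, lineThrough (tangentPoint q σ) (tangentDir β σ) = L := by
  have hr : 1 - (r : ℂ) ^ 2 ≠ 0 := right_ne_zero_of_mul_eq_one hβ
  have hm : (m : ℂ) + 1 ≠ 0 := left_ne_zero_of_mul_eq_one hq
  obtain ⟨p, v, rfl, hp, hv1, hv, hvp, heq⟩ := exists_normal_form hr hL h
  have hsign : ∀ j, ∃ b, j ≠ 0 → boolSign b = v j := by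
    intro j
    by_cases hj : j = 0
    · exact ⟨true, fun h => (h hj).elim⟩
    · obtain ⟨b, hb⟩ := exists_boolSign_mul (y := 1) ((hv j hj).trans (one_pow 2).symm)
      exact ⟨b, fun _ => by simpa using hb⟩
  choose s hs using hsign
  obtain ⟨a, b, hb, ha⟩ : ∃ a b : Bool, (if b then boolSign a * β else 0) = v 0 ∧
      (if b then 0 else boolSign a * q) = p 0 := by
    by_cases hv0 : v 0 = 0
    · obtain ⟨a, ha⟩ := exists_boolSign_mul (x := p 0) (y := q) <| by
        apply mul_left_cancel₀ hm
        rw [hv0] at heq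
        linear_combination heq - hq
      exact ⟨a, false, by simp [hv0], by simp [ha]⟩
    · have hp0 := (mul_eq_zero.1 hvp).resolve_left hv0
      obtain ⟨a, ha⟩ := exists_boolSign_mul (x := v 0) (y := β) <| by
        apply mul_right_cancel₀ hr
        rw [hp0] at heq
        linear_combination heq - hβ
      exact ⟨a, true, by simp [ha], by simp [hp0]⟩
  refine ⟨fun j => if j = 0 then a else if j = 1 then b else s j, ?_⟩
  congr 1
  · funext j
    by_cases hj : j = 0
    · subst hj; simpa [tangentPoint] using ha
    · simp [tangentPoint, hj, hp j hj]
  · funext j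
    by_cases hj : j = 0
    · subst hj; simpa [tangentDir] using hb
    by_cases hj1 : j = 1
    · subst hj1; simp [tangentDir, hv1]
    · simp [tangentDir, hj, hj1, hs j hj]

/-- for `n ≥ 4` and `r > 0` with `r ≠ 1` and `r² ≠ 1 − 1/(n−1)`, the `2n−2`
spheres of radius `r` centered at the crosspolytope vertices `±eⱼ`, `j = 2,…,n` (1-based
indexing; `1 ≤ j.val` in the 0-based indexing of `Fin n`) have exactly `2ⁿ` complex common
tangent lines. -/
theorem crosspolytope_complex_tangents (n : ℕ) (hn : 4 ≤ n) (r : ℝ) (hr : 0 < r)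
    (hr1 : r ≠ 1) (hr2 : r ^ 2 ≠ 1 - 1 / ((n : ℝ) - 1)) :
    (({L | Module.finrank ℂ L.direction = 1 ∧
        ∀ j : Fin n, 1 ≤ j.val →
          IsTangentLine L (Pi.single j 1 : Fin n → ℂ) r ∧
          IsTangentLine L (-(Pi.single j 1 : Fin n → ℂ)) r} :
        Set (AffineSubspace ℂ (Fin n → ℂ))).Finite) ∧
    (({L | Module.finrank ℂ L.direction = 1 ∧
        ∀ j : Fin n, 1 ≤ j.val →
          IsTangentLine L (Pi.single j 1 : Fin n → ℂ) r ∧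
          IsTangentLine L (-(Pi.single j 1 : Fin n → ℂ)) r} :
        Set (AffineSubspace ℂ (Fin n → ℂ))).ncard = 2 ^ n) := by
  obtain ⟨m, rfl⟩ : ∃ m, n = m + 2 := ⟨n - 2, by omega⟩
  have hm : (m : ℝ) + 1 ≠ 0 := by positivity
  have hmC : (m : ℂ) + 1 ≠ 0 := by exact_mod_cast hm
  have hrR : 1 - r ^ 2 ≠ 0 := fun h => hr1 (by nlinarith)
  have hrC : 1 - (r : ℂ) ^ 2 ≠ 0 := by exact_mod_cast hrR
  have hcR : (m + 1) * (1 - r ^ 2) ≠ 1 := by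
    intro h
    apply hr2
    have : ((m + 2 : ℕ) : ℝ) - 1 = m + 1 := by push_cast; ring
    rw [this]
    field_simp
    linear_combination -h
  have hcC : ((m : ℂ) + 1) * (1 - (r : ℂ) ^ 2) ≠ 1 := by exact_mod_cast hcR
  obtain ⟨β, hβ⟩ :=
    IsAlgClosed.exists_pow_nat_eq ((1 - (r : ℂ) ^ 2)⁻¹ - ((m : ℂ) + 1)) Nat.two_pos
  obtain ⟨q, hq⟩ := IsAlgClosed.exists_pow_nat_eq (((m : ℂ) + 1)⁻¹ - (1 - (r : ℂ) ^ 2)) Nat.two_pos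
  replace hβ : (β ^ 2 + (m + 1)) * (1 - (r : ℂ) ^ 2) = 1 := by
    rw [hβ]; field_simp; ring
  replace hq : ((m : ℂ) + 1) * (q ^ 2 + 1 - (r : ℂ) ^ 2) = 1 := by
    rw [hq]; field_simp; ring
  have hβ0 : β ≠ 0 := by rintro rfl; exact hcC (by linear_combination hβ)
  have hq0 : q ≠ 0 := by rintro rfl; exact hcC (by linear_combination hq)
  have hset : {L : AffineSubspace ℂ (Fin (m + 2) → ℂ) | Module.finrank ℂ L.direction = 1 ∧
      ∀ j : Fin (m + 2), 1 ≤ j.val →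
        IsTangentLine L (Pi.single j 1) r ∧ IsTangentLine L (-Pi.single j 1) r} =
      Set.range fun σ : Fin (m + 2) → Bool =>
        lineThrough (tangentPoint q σ) (tangentDir β σ) := by
    ext L
    constructor
    · rintro ⟨hL, h⟩
      exact exists_tangent_param hβ hq hL h
    · rintro ⟨σ, rfl⟩
      exact tangent_param_mem hβ hq σ
  rw [hset]
  refine ⟨Set.finite_range _, ?_⟩
  rw [← Set.image_univ, Set.ncard_image_of_injective _ (tangent_param_injective hβ0 hq0),
    Set.ncard_univ, Nat.card_eq_fintype_card]
  simp
end

section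
/- Let n ≥ 2 and let B_1, …, B_{2n−2} be symmetric bilinear forms on ℂ^{n+1}. Call a two-dimensional linear subspace W ⊆ ℂ^{n+1} tangent to B if for some (equivalently, every) basis u, w of W one has B(u,u)·B(w,w) = B(u,w)². If the set of two-dimensional subspaces W of ℂ^{n+1} that are tangent to every B_i is finite, then this set has at most 2^{2n−2}·C_{n−1} elements, where C_{n−1} = (1/n)·binom(2n−2, n−1) is the (n−1)-st Catalan number. (There are at most 2^{2n−2}·(1/n)·binom(2n−2,n−1) isolated common tangent lines to 2n−2 quadric hypersurfaces in ℙ^n_ℂ.) -/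
namespace MvPolynomial

theorem homogeneousComponent_mul_of_isHomogeneous {σ R : Type*} [CommSemiring R]
    {s : MvPolynomial σ R} {m : ℕ} (hs : s.IsHomogeneous m) (c : MvPolynomial σ R) (n : ℕ) :
    homogeneousComponent n (c * s) =
      if m ≤ n then homogeneousComponent (n - m) c * s else 0 := by
  have hc : ∀ i, homogeneousComponent n (homogeneousComponent i c * s) =
      if i + m = n then homogeneousComponent i c * s else 0 := fun i => by
    rw [homogeneousComponent_of_mem
      ((homogeneousComponent_isHomogeneous i c).mul hs : _ ∈ homogeneousSubmodule σ R (i + m))]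
    simp only [eq_comm]
  conv_lhs => rw [← sum_homogeneousComponent c, Finset.sum_mul, map_sum]
  simp only [hc]
  split_ifs with h
  · rw [Finset.sum_eq_single (n - m)]
    · rw [if_pos (Nat.sub_add_cancel h)]
    · intro b _ hb
      rw [if_neg (by omega)]
    · intro hb
      rw [homogeneousComponent_eq_zero _ _ (by rw [Finset.mem_range] at hb; omega), zero_mul,
        ite_self]
  · exact Finset.sum_eq_zero fun i _ => if_neg (by omega)

/-- A graded form of the projective Nullstellensatz: if the positive-degree forms `G i` have no
common zero on the projective variety with homogeneous coordinate ring `S`, then `S` is finite over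
the subalgebra that they generate. -/
theorem finite_adjoin_of_zeroLocus_trivial {σ ι K S : Type*} [Finite σ] [Field K] [IsAlgClosed K]
    [CommRing S] [Algebra K S] (φ : MvPolynomial σ K →ₐ[K] S) (hφ : Function.Surjective φ)
    (hker : ∀ h, φ h = 0 → ∀ k, φ (homogeneousComponent k h) = 0)
    (G : ι → MvPolynomial σ K) (e : ι → ℕ) (he : ∀ i, 0 < e i) (hG : ∀ i, (G i).IsHomogeneous (e i))
    (hzero : ∀ x : σ → K, (∀ h, φ h = 0 → aeval x h = 0) → (∀ i, aeval x (G i) = 0) → x = 0) :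
    Module.Finite (Algebra.adjoin K (Set.range fun i => φ (G i))) S := by
  set A := Algebra.adjoin K (Set.range fun i => φ (G i))
  set J : Ideal (MvPolynomial σ K) := Ideal.span (Set.range G) ⊔ RingHom.ker φ
  have hJ : Ideal.span (Set.range X) ≤ J.radical := by
    rw [← vanishingIdeal_zeroLocus_eq_radical (K := K), Ideal.span_le]
    rintro _ ⟨i, rfl⟩ x hx
    have := hzero x (fun h hh => hx h (Ideal.mem_sup_right hh))
      (fun i => hx _ (Ideal.mem_sup_left (Ideal.subset_span ⟨i, rfl⟩)))
    simp [this]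
  obtain ⟨M, hM⟩ := Ideal.exists_pow_le_of_le_radical_of_fg hJ
    (Submodule.fg_span (Set.finite_range _))
  choose W hW using fun k => homogeneousSubmodule_fg (σ := σ) (R := K) k
  set N : Submodule A S := Submodule.span A (⋃ k ∈ Finset.range M, φ '' (W k))
  suffices hN : ∀ k, ∀ h : MvPolynomial σ K, h.IsHomogeneous k → φ h ∈ N by
    classical
    refine ⟨⟨((Finset.range M).biUnion fun k => (W k).image φ), ?_⟩⟩
    rw [eq_top_iff]
    rintro s -
    obtain ⟨h, rfl⟩ := hφ s
    rw [← sum_homogeneousComponent h, map_sum]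
    refine Submodule.sum_mem _ fun k _ => ?_
    have := hN k _ (homogeneousComponent_isHomogeneous k h)
    simpa [N] using this
  intro k
  induction k using Nat.strong_induction_on with
  | _ k ih =>
    intro h hh
    rcases lt_or_ge k M with hk | hk
    · have h1 : h ∈ Submodule.span K (W k : Set (MvPolynomial σ K)) := by
        rw [hW]; exact hh
      have h2 := Submodule.mem_map_of_mem (f := φ.toLinearMap) h1
      rw [Submodule.map_span] at h2
      refine Submodule.span_le_restrictScalars K A _ (Submodule.span_mono ?_ h2)
      exact Set.subset_biUnion_of_mem (u := fun k => φ '' (W k : Set (MvPolynomial σ K)))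
        (Finset.mem_coe.2 (Finset.mem_range.2 hk))
    · have hX : h ∈ Ideal.span (Set.range (X : σ → MvPolynomial σ K)) ^ k :=
        (Ideal.mem_span_pow_iff_exists_isHomogeneous _ _).2
          ⟨map C h, hh.map _, by rw [eval_map, eval₂_eta]⟩
      obtain ⟨a, ha, b, hb, rfl⟩ := Submodule.mem_sup.1 (hM (Ideal.pow_le_pow_right hk hX))
      have hab : φ (a + b) = φ (homogeneousComponent k a) := by
        conv_lhs => rw [← homogeneousComponent_eq_self hh]
        rw [map_add, map_add, hker b hb, add_zero]
      rw [hab]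
      clear hab hX hh
      have key : ∀ c, φ (homogeneousComponent k (c * a)) ∈ N := by
        induction ha using Submodule.span_induction with
        | mem x hx =>
          obtain ⟨i, rfl⟩ := hx
          intro c
          rw [homogeneousComponent_mul_of_isHomogeneous (hG i)]
          split_ifs with hi
          · rw [map_mul, mul_comm]
            exact N.smul_mem (⟨φ (G i), Algebra.subset_adjoin ⟨i, rfl⟩⟩ : A)
              (ih _ (by have := he i; omega) _ (homogeneousComponent_isHomogeneous _ _))
          · simp
        | zero => simp
        | add x y _ _ hx hy =>
          intro c
          rw [mul_add, map_add, map_add]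
          exact N.add_mem (hx c) (hy c)
        | smul r x _ hx =>
          intro c
          rw [smul_eq_mul, ← mul_assoc]
          exact hx _
      simpa using key 1

theorem aeval_smul_of_isHomogeneous {σ R : Type*} [CommSemiring R] {p : MvPolynomial σ R} {n : ℕ}
    (hp : p.IsHomogeneous n) (c : R) (x : σ → R) : aeval (c • x) p = c ^ n * aeval x p := by
  simp only [aeval_def, eval₂_eq, Finset.mul_sum]
  refine Finset.sum_congr rfl fun s hs => ?_
  have hc : c ^ n = ∏ i ∈ s.support, c ^ s i := by
    rw [Finset.prod_pow_eq_pow_sum]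
    congr 1
    exact hp.degree_eq_sum_deg_support hs
  simp only [Pi.smul_apply, smul_eq_mul, mul_pow, Finset.prod_mul_distrib, hc]
  ring

theorem finite_aeval_of_finite_adjoin {ι K S : Type*} [CommRing K] [CommRing S] [Algebra K S]
    (f : ι → S) [Module.Finite (Algebra.adjoin K (Set.range f)) S] :
    (aeval f : MvPolynomial ι K →ₐ[K] S).toRingHom.Finite := by
  have h1 : (Algebra.adjoin K (Set.range f)).val.toRingHom.Finite :=
    inferInstanceAs (Module.Finite (Algebra.adjoin K (Set.range f)) S)
  have h : Algebra.adjoin K (Set.range f) = (aeval f : MvPolynomial ι K →ₐ[K] S).range :=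
    Algebra.adjoin_range_eq_range_aeval K f
  rw [h] at h1
  exact h1.comp (RingHom.Finite.of_surjective _
    (aeval f : MvPolynomial ι K →ₐ[K] S).rangeRestrict_surjective)

end MvPolynomial

theorem le_two_pow_mul_of_forall_mul_choose_le {m D d : ℕ}
    (h : ∀ k, m * (k + d).choose d ≤ D * (2 * k + m + d).choose d) : m ≤ 2 ^ d * D := by
  have key : ∀ k : ℕ, (m : ℝ) ≤ D * (2 + (m + d : ℝ) * ((k : ℝ) + 1)⁻¹) ^ d := fun k => by
    have h1 : m * (k + 1) ^ d ≤ D * (2 * k + m + d) ^ d := by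
      have h2 := Nat.mul_le_mul_left d.factorial (h k)
      have h3 := Nat.pow_sub_le_descFactorial (k + d) d
      rw [Nat.descFactorial_eq_factorial_mul_choose, show k + d + 1 - d = k + 1 by omega] at h3
      have h4 := Nat.descFactorial_le_pow (2 * k + m + d) d
      rw [Nat.descFactorial_eq_factorial_mul_choose] at h4
      calc m * (k + 1) ^ d ≤ m * (d.factorial * (k + d).choose d) := Nat.mul_le_mul_left _ h3
        _ = d.factorial * (m * (k + d).choose d) := by ring
        _ ≤ d.factorial * (D * (2 * k + m + d).choose d) := h2
        _ = D * (d.factorial * (2 * k + m + d).choose d) := by ring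
        _ ≤ _ := Nat.mul_le_mul_left _ h4
    have h5 : (m : ℝ) * (k + 1) ^ d ≤ D * (2 * k + m + d) ^ d := by exact_mod_cast h1
    have hk : (0 : ℝ) < k + 1 := by positivity
    have h6 : (2 * (k : ℝ) + m + d) ^ d ≤ (2 + (m + d : ℝ) * ((k : ℝ) + 1)⁻¹) ^ d * (k + 1) ^ d := by
      rw [← mul_pow]
      gcongr
      rw [add_mul, mul_assoc, inv_mul_cancel₀ hk.ne']
      linarith
    refine le_of_mul_le_mul_right ?_ (pow_pos hk d)
    calc _ ≤ _ := h5
      _ ≤ (D : ℝ) * ((2 + (m + d : ℝ) * ((k : ℝ) + 1)⁻¹) ^ d * (k + 1) ^ d) := by gcongr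
      _ = _ := by ring
  have hlim : Filter.Tendsto (fun k : ℕ => (D : ℝ) * (2 + (m + d : ℝ) * ((k : ℝ) + 1)⁻¹) ^ d)
      Filter.atTop (nhds (D * (2 + (m + d : ℝ) * 0) ^ d)) := by
    have := tendsto_one_div_add_atTop_nhds_zero_nat (𝕜 := ℝ)
    simp only [one_div] at this
    exact (((this.const_mul _).const_add _).pow d).const_mul _
  have := ge_of_tendsto' hlim key
  rw [mul_zero, add_zero, mul_comm] at this
  exact_mod_cast this

/-- The number of points of a fibre of an integral extension of an integrally closed domain is at
most the degree of the minimal polynomial of an element separating them. -/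
theorem card_le_natDegree_minpoly {A S K ι : Type*} [CommRing A] [CommRing S] [Algebra A S]
    [Field K] [Fintype ι] {g : S} (hg : IsIntegral A g)
    (ψ : A →+* K) (χ : ι → S →+* K) (hχ : ∀ i, (χ i).comp (algebraMap A S) = ψ)
    (hinj : Function.Injective fun i => χ i g) : Fintype.card ι ≤ (minpoly A g).natDegree := by
  classical
  have hmonic := (minpoly.monic hg).map ψ
  have hroot : ∀ i, χ i g ∈ ((minpoly A g).map ψ).roots := fun i => by
    rw [Polynomial.mem_roots hmonic.ne_zero, Polynomial.IsRoot, Polynomial.eval_map, ← hχ i,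
      ← Polynomial.hom_eval₂, ← Polynomial.aeval_def, minpoly.aeval, map_zero]
  calc Fintype.card ι = (Finset.univ.image fun i => χ i g).card := by
        rw [Finset.card_image_of_injective _ hinj, Finset.card_univ]
    _ ≤ ((minpoly A g).map ψ).roots.toFinset.card :=
        Finset.card_le_card fun x hx => by
          obtain ⟨i, -, rfl⟩ := Finset.mem_image.1 hx
          exact Multiset.mem_toFinset.2 (hroot i)
    _ ≤ _ := Multiset.toFinset_card_le _
    _ ≤ _ := Polynomial.card_roots' _
    _ ≤ _ := Polynomial.natDegree_map_le

theorem linearIndependent_pow_of_isIntegrallyClosed {A S : Type*} [CommRing A] [IsDomain A]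
    [IsIntegrallyClosed A] [CommRing S] [IsDomain S] [Algebra A S] [Module.IsTorsionFree A S]
    {g : S} (hg : IsIntegral A g) :
    LinearIndependent A fun j : Fin (minpoly A g).natDegree => g ^ (j : ℕ) := by
  rw [Fintype.linearIndependent_iff]
  intro c hc
  set p : Polynomial A := ∑ j : Fin (minpoly A g).natDegree, Polynomial.monomial (j : ℕ) (c j) with hp
  have hp0 : Polynomial.aeval g p = 0 := by
    rw [hp, map_sum, ← hc]
    exact Finset.sum_congr rfl fun j _ => by rw [Polynomial.aeval_monomial, Algebra.smul_def]
  have hdeg : p.degree < (minpoly A g).degree := by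
    rw [Polynomial.degree_eq_natDegree (minpoly.ne_zero hg), Polynomial.degree_lt_iff_coeff_zero]
    intro n hn
    rw [hp, Polynomial.finsetSum_coeff]
    exact Finset.sum_eq_zero fun j _ => Polynomial.coeff_monomial_of_ne _ (by omega)
  have hzero : p = 0 :=
    Polynomial.eq_zero_of_dvd_of_degree_lt (minpoly.isIntegrallyClosed_dvd hg hp0) hdeg
  intro i
  have := congrArg (Polynomial.coeff · (i : ℕ)) hzero
  simpa [hp, Polynomial.finsetSum_coeff, Polynomial.coeff_monomial, Fin.val_inj] using this

open MvPolynomial in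
theorem algebraicIndependent_of_finite_adjoin {K S ι : Type*} [Field K] [CommRing S] [IsDomain S]
    [Algebra K S] [Finite ι] {y f : ι → S} (hy : AlgebraicIndependent K y)
    [Module.Finite (Algebra.adjoin K (Set.range f)) S] : AlgebraicIndependent K f :=
  (Algebra.IsAlgebraic.isTranscendenceBasis_of_lift_le_trdeg_of_finite K f
    hy.lift_cardinalMk_le_trdeg).1

open MvPolynomial in
/-- A lower bound for the Hilbert function of a graded ring containing an integral element `φ P`
over a weighted polynomial ring with `d` generators of degree two and one of degree one. -/
theorem natDegree_minpoly_mul_choose_le_finrank {σ K S : Type*} [Finite σ] [Field K] [CommRing S]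
    [IsDomain S] [Algebra K S] (φ : MvPolynomial σ K →ₐ[K] S) {d : ℕ}
    (G : Option (Fin d) → MvPolynomial σ K) (hG0 : (G none).IsHomogeneous 1)
    (hG : ∀ i, (G (some i)).IsHomogeneous 2) (P : MvPolynomial σ K) (hP : P.IsHomogeneous 1)
    [Algebra (MvPolynomial (Option (Fin d)) K) S]
    [IsScalarTower K (MvPolynomial (Option (Fin d)) K) S]
    [Module.IsTorsionFree (MvPolynomial (Option (Fin d)) K) S]
    (halg : ∀ q, algebraMap (MvPolynomial (Option (Fin d)) K) S q = φ (aeval G q))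
    (hint : IsIntegral (MvPolynomial (Option (Fin d)) K) (φ P)) (k : ℕ) :
    (minpoly (MvPolynomial (Option (Fin d)) K) (φ P)).natDegree * (k + d).choose d ≤
      Module.finrank K ((homogeneousSubmodule σ K
        (2 * k + (minpoly (MvPolynomial (Option (Fin d)) K) (φ P)).natDegree)).map
          φ.toLinearMap) := by
  classical
  set m := (minpoly (MvPolynomial (Option (Fin d)) K) (φ P)).natDegree with hm
  have hli := linearIndependent_smul (R := K)
    (basisMonomials (Option (Fin d)) K).linearIndependent
    (linearIndependent_pow_of_isIntegrallyClosed hint)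
  let s : Sym (Option (Fin d)) k × Fin m → (Option (Fin d) →₀ ℕ) := fun t =>
    Multiset.toFinsupp (t.1 : Multiset (Option (Fin d))) +
      Finsupp.single none ((t.1 : Multiset (Option (Fin d))).count none + (m - t.2))
  have hs : Function.Injective fun t : Sym (Option (Fin d)) k × Fin m => (s t, t.2) := by
    rintro ⟨t, j⟩ ⟨t', j'⟩ h
    obtain ⟨h1, rfl⟩ := Prod.mk.inj h
    refine Prod.ext (Sym.coe_injective (Multiset.ext.2 fun a => ?_)) rfl
    have h2 := DFunLike.congr_fun h1 a
    cases a with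
    | none =>
      simp only [s, Finsupp.add_apply, Multiset.toFinsupp_apply, Finsupp.single_eq_same] at h2 ⊢
      omega
    | some i => simpa [s] using h2
  have hli' := hli.comp _ hs
  set N := (homogeneousSubmodule σ K (2 * k + m)).map φ.toLinearMap
  have hmem : ∀ t : Sym (Option (Fin d)) k × Fin m,
      basisMonomials (Option (Fin d)) K (s t) • (φ P) ^ (t.2 : ℕ) ∈ N := by
    intro t
    refine ⟨aeval G (basisMonomials (Option (Fin d)) K (s t)) * P ^ (t.2 : ℕ), ?_, ?_⟩
    · have hw : ∀ o, (G o).IsHomogeneous (o.elim 1 fun _ => 2) := by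
        rintro (_ | i)
        exacts [hG0, hG i]
      have h1 := IsHomogeneous.prod Finset.univ (fun o => G o ^ s t o) _
        fun o _ => (hw o).pow (s t o)
      have h2 := h1.mul (hP.pow (t.2 : ℕ))
      have hcard : ∑ o, (t.1 : Multiset (Option (Fin d))).count o = k := by
        rw [Multiset.sum_count_eq_card fun a _ => Finset.mem_univ a]
        exact t.1.2
      have hdeg : ∑ o : Option (Fin d), (o.elim 1 fun _ => 2) * s t o + 1 * (t.2 : ℕ) =
          2 * k + m := by
        rw [Fintype.sum_option] at hcard ⊢
        have := t.2.2
        simp only [s, Option.elim, Finsupp.add_apply, Multiset.toFinsupp_apply,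
          Finsupp.single_eq_same, Finsupp.single_apply, reduceCtorEq, if_false, ← Finset.mul_sum,
          add_zero]
        omega
      rw [hdeg] at h2
      rw [coe_basisMonomials, aeval_monomial, map_one, one_mul,
        Finsupp.prod_fintype _ _ fun _ => pow_zero _]
      exact h2
    · simp [Algebra.smul_def, halg]
  have : Module.Finite K N := by
    have := Module.Finite.iff_fg.2 (homogeneousSubmodule_fg (σ := σ) (R := K) (2 * k + m))
    infer_instance
  have hli'' : LinearIndependent K fun t : Sym (Option (Fin d)) k × Fin m =>
      (⟨_, hmem t⟩ : N) := LinearIndependent.of_comp N.subtype hli'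
  have := hli''.fintype_card_le_finrank
  rw [Fintype.card_prod, Sym.card_sym_eq_choose, Fintype.card_option, Fintype.card_fin,
    Fintype.card_fin, mul_comm, show d + 1 + k - 1 = k + d by omega, Nat.choose_symm_add] at this
  exact this

open MvPolynomial in
/-- Bézout's bound for the number of common zeros of `d` quadrics on a `d`-dimensional projective
variety whose Hilbert function is at most `D` times that of projective `d`-space. The variety is
given by its homogeneous coordinate ring, the image of `φ`. -/
theorem card_le_two_pow_mul_of_finrank_le {σ K S ι : Type*} [Finite σ] [Field K] [IsAlgClosed K]
    [CommRing S] [IsDomain S] [Algebra K S] [Fintype ι] (φ : MvPolynomial σ K →ₐ[K] S)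
    (hφ : Function.Surjective φ) (hker : ∀ h, φ h = 0 → ∀ k, φ (homogeneousComponent k h) = 0)
    {d D : ℕ} {y : Option (Fin d) → S} (hy : AlgebraicIndependent K y)
    (hS : ∀ k, Module.finrank K ((homogeneousSubmodule σ K k).map φ.toLinearMap) ≤
      D * (k + d).choose d)
    (F : Fin d → MvPolynomial σ K) (hF : ∀ i, (F i).IsHomogeneous 2)
    (v : ι → σ → K) (hv0 : ∀ i, v i ≠ 0) (hvprop : ∀ i j (c : K), v i = c • v j → i = j)
    (hvker : ∀ i h, φ h = 0 → aeval (v i) h = 0) (hvF : ∀ i j, aeval (v i) (F j) = 0)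
    (hzero : ∀ x : σ → K, x ≠ 0 → (∀ h, φ h = 0 → aeval x h = 0) → (∀ j, aeval x (F j) = 0) →
      ∃ i, ∃ c : K, x = c • v i) :
    Fintype.card ι ≤ 2 ^ d * D := by
  classical
  have := Fintype.ofFinite σ
  have hlin : ∀ l : Module.Dual K (σ → K), ∃ P : MvPolynomial σ K, P.IsHomogeneous 1 ∧
      ∀ x, aeval x P = l x := fun l => by
    refine ⟨∑ i, C (l (Pi.single i 1)) * X i,
      IsHomogeneous.sum _ _ _ fun i _ => isHomogeneous_C_mul_X _ _, fun x => ?_⟩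
    conv_rhs => rw [pi_eq_sum_univ' x]
    simp [mul_comm]
  obtain ⟨l, hl⟩ := Module.exists_dual_forall_apply_ne_zero (K := K) v hv0
  obtain ⟨L, hL, hLl⟩ := hlin l
  set w : ι → σ → K := fun i => (l (v i))⁻¹ • v i with hw
  have hwl : ∀ i, l (w i) = 1 := fun i => by simp [hw, hl i]
  have hwinj : ∀ i j, w i = w j → i = j := fun i j h => by
    refine hvprop i j (l (v i) * (l (v j))⁻¹) ?_
    have h2 : l (v i) • w i = l (v i) • w j := by rw [h]
    simpa [hw, smul_smul, hl i] using h2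
  obtain ⟨g, hg⟩ := Module.exists_dual_forall_apply_ne_zero (K := K)
    (fun p : {p : ι × ι // p.1 ≠ p.2} => w p.1.1 - w p.1.2)
    (fun p h => p.2 (hwinj _ _ (sub_eq_zero.1 h)))
  have hginj : Function.Injective fun i => g (w i) := fun i j h => by
    by_contra hij
    exact hg ⟨(i, j), hij⟩ (by rw [map_sub]; exact sub_eq_zero.2 h)
  obtain ⟨P, hP, hPg⟩ := hlin g
  have hwker : ∀ i h, φ h = 0 → aeval (w i) h = 0 := fun i h hh => by
    rw [← sum_homogeneousComponent h, map_sum]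
    refine Finset.sum_eq_zero fun k _ => ?_
    rw [hw, aeval_smul_of_isHomogeneous (homogeneousComponent_isHomogeneous k h),
      hvker i _ (hker h hh k), mul_zero]
  let χ : ι → S →ₐ[K] K := fun i => AlgHom.liftOfSurjective φ hφ (aeval (w i)) (hwker i)
  have hχ : ∀ i h, χ i (φ h) = aeval (w i) h := fun i h =>
    AlgHom.liftOfSurjective_apply _ _ _ _ _
  let G : Option (Fin d) → MvPolynomial σ K := fun o => o.elim L F
  have : Module.Finite (Algebra.adjoin K (Set.range fun o => φ (G o))) S := by
    refine finite_adjoin_of_zeroLocus_trivial φ hφ hker G (fun o => o.elim 1 fun _ => 2) ?_ ?_ ?_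
    · rintro (_ | i) <;> simp
    · rintro (_ | i)
      exacts [hL, hF i]
    · intro x hx hG
      by_contra hx0
      obtain ⟨i, c, rfl⟩ := hzero x hx0 hx fun j => hG (some j)
      have h1 : aeval (c • v i) L = 0 := hG none
      rw [hLl, map_smul, smul_eq_mul, mul_eq_zero, or_iff_left (hl i)] at h1
      exact hx0 (by rw [h1, zero_smul])
  have hind := algebraicIndependent_of_finite_adjoin (f := fun o => φ (G o)) hy
  have hfin := finite_aeval_of_finite_adjoin (K := K) fun o => φ (G o)
  let a : MvPolynomial (Option (Fin d)) K →ₐ[K] S := aeval fun o => φ (G o)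
  let : Algebra (MvPolynomial (Option (Fin d)) K) S := a.toRingHom.toAlgebra
  have halg : ∀ q, algebraMap (MvPolynomial (Option (Fin d)) K) S q = φ (aeval G q) := fun q => by
    change aeval (fun o => φ (G o)) q = φ (aeval G q)
    rw [← comp_aeval]
    rfl
  have : IsScalarTower K (MvPolynomial (Option (Fin d)) K) S :=
    IsScalarTower.of_algebraMap_eq fun x => (a.commutes x).symm
  have : FaithfulSMul (MvPolynomial (Option (Fin d)) K) S :=
    (faithfulSMul_iff_algebraMap_injective _ _).2 hind
  have : Module.Finite (MvPolynomial (Option (Fin d)) K) S := hfin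
  have hint : IsIntegral (MvPolynomial (Option (Fin d)) K) (φ P) := IsIntegral.of_finite _ _
  have hle := card_le_natDegree_minpoly hint
    (aeval (fun o : Option (Fin d) => o.elim (1 : K) fun _ => 0) : _ →ₐ[K] K).toRingHom
    (fun i => (χ i).toRingHom) (fun i => ?_) (fun i j h => hginj ?_)
  · refine hle.trans (le_two_pow_mul_of_forall_mul_choose_le fun k => ?_)
    exact (natDegree_minpoly_mul_choose_le_finrank φ G hL hF P hP halg hint k).trans (hS _)
  · refine MvPolynomial.ringHom_ext (fun r => ?_) fun o => ?_
    · simp [halg]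
    · cases o with
      | none => simp [halg, hχ, G, hLl, hwl]
      | some j =>
        have := aeval_smul_of_isHomogeneous (hF j) (l (v i))⁻¹ (v i)
        simp [halg, hχ, G, hw, this, hvF]
  · simpa [hχ, hPg] using h

section LatticePaths

open DyckStep

theorem exists_steps_through_chain {m : ℕ} : ∀ (c : List (ℕ × ℕ)) (a b : ℕ), a < b → a ≤ m →
    b ≤ m + 1 → c.Pairwise (· ≤ ·) → (∀ e ∈ c, (a, b) ≤ e ∧ e.1 < e.2 ∧ e.2 ≤ m + 1) →
    ∃ l : List DyckStep, a + l.count D = m ∧ b + l.count U = m + 1 ∧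
      (∀ τ, a + (l.take τ).count D < b + (l.take τ).count U) ∧
      ∀ e ∈ c, ∃ τ, e = (a + (l.take τ).count D, b + (l.take τ).count U) := by
  have hcount : ∀ p q τ (l : List DyckStep),
      (((List.replicate p U ++ (List.replicate q D ++ l))).take τ).count U =
        min τ p + (l.take (τ - p - q)).count U ∧
      (((List.replicate p U ++ (List.replicate q D ++ l))).take τ).count D =
        min (τ - p) q + (l.take (τ - p - q)).count D := by
    intro p q τ l
    simp [List.take_append, List.count_replicate]
  have hprefix : ∀ p q a b (l : List DyckStep), a < b →
      (∀ τ, a + q + (l.take τ).count D < b + p + (l.take τ).count U) →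
      ∀ τ, a + ((List.replicate p U ++ (List.replicate q D ++ l)).take τ).count D <
        b + ((List.replicate p U ++ (List.replicate q D ++ l)).take τ).count U := by
    intro p q a b l hab hl τ
    rw [(hcount p q τ l).1, (hcount p q τ l).2]
    rcases le_total (p + q) τ with h | h
    · have := hl (τ - p - q)
      omega
    · have := hl 0
      rw [show τ - p - q = 0 by omega]
      simp only [List.take_zero, List.count_nil] at this ⊢
      omega
  intro c
  induction c with
  | nil =>
    intro a b hab ha hb _ _
    refine ⟨List.replicate (m + 1 - b) U ++ (List.replicate (m - a) D ++ []), ?_, ?_,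
      hprefix _ _ _ _ _ hab fun τ => ?_, by simp⟩
    · simp [List.count_replicate]; omega
    · simp [List.count_replicate]; omega
    · simp; omega
  | cons e c ih =>
    intro a b hab ha hb hc he
    obtain ⟨⟨hae, hbe⟩, hee, hem⟩ := he e (by simp)
    rw [List.pairwise_cons] at hc
    dsimp only at hae hbe
    obtain ⟨l, hD, hU, hlt, hmem⟩ := ih e.1 e.2 hee (by omega) hem hc.2
      fun f hf => ⟨hc.1 f hf, (he f (by simp [hf])).2⟩
    have hq : a + (e.1 - a) = e.1 := by omega
    have hp : b + (e.2 - b) = e.2 := by omega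
    refine ⟨List.replicate (e.2 - b) U ++ (List.replicate (e.1 - a) D ++ l), ?_, ?_,
      hprefix _ _ _ _ _ hab fun τ => ?_, fun f hf => ?_⟩
    · simp [List.count_replicate]; omega
    · simp [List.count_replicate]; omega
    · rw [hq, hp]; exact hlt τ
    · rcases List.mem_cons.1 hf with rfl | hf
      · refine ⟨(f.2 - b) + (f.1 - a), ?_⟩
        rw [(hcount _ _ _ _).1, (hcount _ _ _ _).2]
        ext <;> simp <;> omega
      · obtain ⟨τ, hτ⟩ := hmem f hf
        refine ⟨(e.2 - b) + (e.1 - a) + τ, ?_⟩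
        rw [(hcount _ _ _ _).1, (hcount _ _ _ _).2, hτ,
          show (e.2 - b) + (e.1 - a) + τ - (e.2 - b) - (e.1 - a) = τ by omega]
        ext <;> simp <;> omega

/-- The lattice point reached by the Dyck word `w` after `τ` steps, starting from `(0, 1)`. -/
def DyckWord.latticePoint {m : ℕ} (w : DyckWord) (τ : Fin (2 * m + 1)) : Fin (m + 2) × Fin (m + 2) :=
  (Fin.ofNat (m + 2) ((w.toList.take τ).count D), Fin.ofNat (m + 2) ((w.toList.take τ).count U + 1))

theorem exists_dyckWord_through_chain {m : ℕ} (t : Multiset (Fin (m + 2) × Fin (m + 2)))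
    (hlt : ∀ e ∈ t, e.1 < e.2) (hchain : ∀ e ∈ t, ∀ f ∈ t, e ≤ f ∨ f ≤ e) :
    ∃ w : DyckWord, w.semilength = m ∧ ∀ e ∈ t, ∃ τ : Fin (2 * m + 1), w.latticePoint τ = e := by
  let v : Fin (m + 2) × Fin (m + 2) → ℕ × ℕ := fun e => (e.1, e.2)
  let r : ℕ × ℕ → ℕ × ℕ → Prop := fun e f => e.1 + e.2 ≤ f.1 + f.2
  have : Std.Total r := ⟨fun e f => le_total _ _⟩
  have : IsTrans (ℕ × ℕ) r := ⟨fun _ _ _ => le_trans⟩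
  let c := (t.toList.map v).insertionSort r
  have hc : ∀ e, e ∈ c ↔ ∃ f ∈ t, v f = e := fun e => by
    simp [c, (List.perm_insertionSort r _).mem_iff]
  have hsorted : c.Pairwise (· ≤ ·) := by
    refine List.Pairwise.imp_of_mem ?_ (List.pairwise_insertionSort r (t.toList.map v))
    intro e f he hf hef
    obtain ⟨e, he', rfl⟩ := (hc e).1 he
    obtain ⟨f, hf', rfl⟩ := (hc f).1 hf
    have : (e.1 : ℕ) + e.2 ≤ f.1 + f.2 := hef
    rcases hchain e he' f hf' with h | h
    · exact ⟨h.1, h.2⟩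
    · have h1 : (f.1 : ℕ) ≤ e.1 := h.1
      have h2 : (f.2 : ℕ) ≤ e.2 := h.2
      constructor <;> simp [v] <;> omega
  obtain ⟨l, hD, hU, hpre, hmem⟩ := exists_steps_through_chain (m := m) c 0 1 (by simp) (by simp)
    (by simp) hsorted fun e he => by
      obtain ⟨f, hf, rfl⟩ := (hc e).1 he
      have h1 : (f.1 : ℕ) < f.2 := hlt f hf
      have h2 := f.2.2
      exact ⟨⟨Nat.zero_le _, by simp [v]; omega⟩, h1, by simp [v]; omega⟩
  refine ⟨⟨l, by omega, fun i => by have := hpre i; omega⟩, ?_, fun e he => ?_⟩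
  · simp only [DyckWord.semilength]; omega
  · obtain ⟨τ, hτ⟩ := hmem (v e) ((hc _).2 ⟨e, he, rfl⟩)
    have hlen : l.length = 2 * m := by
      have : l.length = l.count U + l.count D := by
        clear hD hU hpre hmem hτ
        induction l with
        | nil => rfl
        | cons s l ih => cases s <;> simp [ih] <;> omega
      omega
    refine ⟨⟨min τ l.length, by omega⟩, ?_⟩
    have htake : l.take (min τ l.length) = l.take τ := by
      rw [← List.take_take, List.take_length]
    simp only [DyckWord.latticePoint, htake]
    have h1 : (e.1 : ℕ) = 0 + (l.take τ).count D := congrArg Prod.fst hτ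
    have h2 : (e.2 : ℕ) = 1 + (l.take τ).count U := congrArg Prod.snd hτ
    have := e.1.2
    have := e.2.2
    refine Prod.ext (Fin.ext ?_) (Fin.ext ?_)
    · simp only [Fin.val_ofNat]
      rw [Nat.mod_eq_of_lt] <;> omega
    · simp only [Fin.val_ofNat]
      rw [Nat.mod_eq_of_lt] <;> omega

end LatticePaths

section PluckerRelations

variable {K S : Type*} [Field K] [CommRing S] [Algebra K S]

theorem prod_mem_span_standard {n : ℕ} (p : Fin n × Fin n → S)
    (hrel : ∀ i j k l, p (i, l) * p (j, k) = p (i, k) * p (j, l) - p (i, j) * p (k, l))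
    (t : Multiset (Fin n × Fin n)) (ht : ∀ e ∈ t, e.1 < e.2) :
    (t.map p).prod ∈ Submodule.span K {x | ∃ s : Multiset (Fin n × Fin n), s.card = t.card ∧
      (∀ e ∈ s, e.1 < e.2) ∧ (∀ e ∈ s, ∀ f ∈ s, e ≤ f ∨ f ≤ e) ∧ (s.map p).prod = x} := by
  generalize hM : (t.map fun e => ((e.2 : ℕ) - e.1) ^ 2).sum = M
  induction M using Nat.strong_induction_on generalizing t with
  | _ M ih =>
    by_cases hchain : ∀ e ∈ t, ∀ f ∈ t, e ≤ f ∨ f ≤ e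
    · exact Submodule.subset_span ⟨t, rfl, ht, hchain, rfl⟩
    push Not at hchain
    obtain ⟨e, f, he, hf, h1, h2⟩ : ∃ e f, e ∈ t ∧ f ∈ t ∧ e.1 < f.1 ∧ f.2 < e.2 := by
      obtain ⟨e, he, f, hf, hef, hfe⟩ := hchain
      rw [Prod.le_def, not_and_or, not_le, not_le] at hef hfe
      rcases hef with h | h <;> rcases hfe with h' | h'
      · exact absurd h' h.asymm
      · exact ⟨f, e, hf, he, h, h'⟩
      · exact ⟨e, f, he, hf, h', h⟩
      · exact absurd h' h.asymm
    obtain ⟨t, rfl⟩ := Multiset.exists_cons_of_mem he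
    have hf' : f ∈ t := (Multiset.mem_cons.1 hf).resolve_left fun h => by simp [h] at h1
    obtain ⟨t, rfl⟩ := Multiset.exists_cons_of_mem hf'
    obtain ⟨i, l⟩ := e
    obtain ⟨j, k⟩ := f
    have hjk : j < k := ht (j, k) hf
    dsimp only at h1 h2
    have hM1 : ((k : ℕ) - i) ^ 2 + ((l : ℕ) - j) ^ 2 < ((l : ℕ) - i) ^ 2 + ((k : ℕ) - j) ^ 2 ∧
        ((j : ℕ) - i) ^ 2 + ((l : ℕ) - k) ^ 2 < ((l : ℕ) - i) ^ 2 + ((k : ℕ) - j) ^ 2 := by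
      obtain ⟨a, ha⟩ := Nat.exists_eq_add_of_lt (Fin.lt_def.1 h1)
      obtain ⟨b, hb⟩ := Nat.exists_eq_add_of_lt (Fin.lt_def.1 hjk)
      obtain ⟨c, hc⟩ := Nat.exists_eq_add_of_lt (Fin.lt_def.1 h2)
      rw [show (k : ℕ) - i = a + 1 + (b + 1) by omega, show (l : ℕ) - j = b + 1 + (c + 1) by omega,
        show (l : ℕ) - i = a + 1 + (b + 1) + (c + 1) by omega, show (k : ℕ) - j = b + 1 by omega,
        show (j : ℕ) - i = a + 1 by omega, show (l : ℕ) - k = c + 1 by omega]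
      constructor <;> nlinarith [Nat.zero_le (a * b), Nat.zero_le (a * c), Nat.zero_le (b * c)]
    have hexp : (((i, l) ::ₘ (j, k) ::ₘ t).map p).prod =
        (((i, k) ::ₘ (j, l) ::ₘ t).map p).prod - (((i, j) ::ₘ (k, l) ::ₘ t).map p).prod := by
      simp only [Multiset.map_cons, Multiset.prod_cons, ← mul_assoc, hrel i j k l]
      ring
    rw [hexp]
    simp only [Multiset.map_cons, Multiset.sum_cons, Multiset.mem_cons] at hM ht
    refine Submodule.sub_mem _ ?_ ?_
    · simpa using ih _ (by simp only [Multiset.map_cons, Multiset.sum_cons]; omega)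
        ((i, k) ::ₘ (j, l) ::ₘ t) (fun g hg => by
          rcases Multiset.mem_cons.1 hg with rfl | hg
          · exact h1.trans hjk
          rcases Multiset.mem_cons.1 hg with rfl | hg
          · exact hjk.trans h2
          · exact ht g (Or.inr (Or.inr hg))) rfl
    · simpa using ih _ (by simp only [Multiset.map_cons, Multiset.sum_cons]; omega)
        ((i, j) ::ₘ (k, l) ::ₘ t) (fun g hg => by
          rcases Multiset.mem_cons.1 hg with rfl | hg
          · exact h1
          rcases Multiset.mem_cons.1 hg with rfl | hg
          · exact h2
          · exact ht g (Or.inr (Or.inr hg))) rfl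

theorem exists_increasing_prod_eq {n : ℕ} (p : Fin n × Fin n → S) (hdiag : ∀ i, p (i, i) = 0)
    (hanti : ∀ i j, p (j, i) = -p (i, j)) (t : Multiset (Fin n × Fin n)) :
    ∃ s : Multiset (Fin n × Fin n), ∃ c : K, s.card = t.card ∧ (∀ e ∈ s, e.1 < e.2 ∨ c = 0) ∧
      (t.map p).prod = c • (s.map p).prod := by
  induction t using Multiset.induction_on with
  | empty => exact ⟨0, 1, by simp⟩
  | cons e t ih =>
    obtain ⟨s, c, hs, hlt, hprod⟩ := ih
    obtain ⟨i, j⟩ := e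
    rcases lt_trichotomy i j with h | rfl | h
    · refine ⟨(i, j) ::ₘ s, c, by simp [hs], fun f hf => ?_, by simp [hprod]⟩
      rcases Multiset.mem_cons.1 hf with rfl | hf
      exacts [Or.inl h, hlt f hf]
    · exact ⟨(i, i) ::ₘ s, 0, by simp [hs], by simp, by simp [hdiag]⟩
    · refine ⟨(j, i) ::ₘ s, -c, by simp [hs], fun f hf => ?_, by simp [hprod, hanti j i]⟩
      rcases Multiset.mem_cons.1 hf with rfl | hf
      exacts [Or.inl h, (hlt f hf).imp_right fun h => by simp [h]]

theorem finrank_map_homogeneousSubmodule_le {m : ℕ} (p : Fin (m + 2) × Fin (m + 2) → S)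
    (hdiag : ∀ i, p (i, i) = 0) (hanti : ∀ i j, p (j, i) = -p (i, j))
    (hrel : ∀ i j k l, p (i, l) * p (j, k) = p (i, k) * p (j, l) - p (i, j) * p (k, l)) (k : ℕ) :
    Module.finrank K ((MvPolynomial.homogeneousSubmodule (Fin (m + 2) × Fin (m + 2)) K k).map
      (MvPolynomial.aeval (R := K) p).toLinearMap) ≤ catalan m * (k + 2 * m).choose (2 * m) := by
  let g : {w : DyckWord // w.semilength = m} × Sym (Fin (2 * m + 1)) k → S := fun x =>
    ((x.2 : Multiset (Fin (2 * m + 1))).map fun τ => p (x.1.1.latticePoint τ)).prod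
  have hle : (MvPolynomial.homogeneousSubmodule (Fin (m + 2) × Fin (m + 2)) K k).map
      (MvPolynomial.aeval (R := K) p).toLinearMap ≤ Submodule.span K (Set.range g) := by
    have hstd : ∀ t : Multiset (Fin (m + 2) × Fin (m + 2)), t.card = k →
        (t.map p).prod ∈ Submodule.span K (Set.range g) := by
      intro t ht
      obtain ⟨s, c, hs, hlt, hprod⟩ := exists_increasing_prod_eq (K := K) p hdiag hanti t
      rw [hprod]
      by_cases hc : c = 0
      · simp [hc]
      refine Submodule.smul_mem _ _ (Submodule.span_le.2 ?_
        (prod_mem_span_standard p hrel s fun e he => (hlt e he).resolve_right hc))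
      rintro _ ⟨r, hr, hlt, hchain, rfl⟩
      obtain ⟨w, hw, hmem⟩ := exists_dyckWord_through_chain r hlt hchain
      choose! τ hτ using hmem
      refine Submodule.subset_span ⟨⟨⟨w, hw⟩, ⟨r.map τ, by simp [hr, hs, ht]⟩⟩, ?_⟩
      simp only [g, Sym.coe_mk, Multiset.map_map]
      congr 1
      exact Multiset.map_congr rfl fun e he => by simp [hτ e he]
    rintro _ ⟨q, hq, rfl⟩
    have hq : q.IsHomogeneous k := hq
    rw [AlgHom.toLinearMap_apply, q.as_sum, map_sum]
    refine Submodule.sum_mem _ fun d hd => ?_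
    rw [MvPolynomial.aeval_monomial, ← Algebra.smul_def]
    refine Submodule.smul_mem _ _ ?_
    have := hstd (Finsupp.toMultiset d) (by
      rw [Finsupp.card_toMultiset]
      have := hq (MvPolynomial.mem_support_iff.1 hd)
      simpa [Finsupp.weight_apply, Function.id_def] using this)
    rwa [Finsupp.toMultiset_map, Finsupp.prod_toMultiset, Finsupp.prod_mapDomain_index (by simp)
      (by simp [pow_add])] at this
  calc _ ≤ Module.finrank K (Submodule.span K (Set.range g)) := by
        have : FiniteDimensional K (Submodule.span K (Set.range g)) :=
          FiniteDimensional.span_of_finite K (Set.finite_range g)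
        exact Submodule.finrank_mono hle
    _ ≤ Fintype.card ({w : DyckWord // w.semilength = m} × Sym (Fin (2 * m + 1)) k) :=
        finrank_range_le_card g
    _ = _ := by
        rw [Fintype.card_prod, DyckWord.card_dyckWord_semilength_eq_catalan,
          Sym.card_sym_eq_choose, Fintype.card_fin,
          show 2 * m + 1 + k - 1 = k + 2 * m by omega, Nat.choose_symm_add]

end PluckerRelations

section GenericMinors

open MvPolynomial

/-- The `2 × 2` minors of the matrix with rows `u` and `w`. -/
def pluckerVec {N : ℕ} {R : Type*} [CommRing R] (u w : Fin N → R) (e : Fin N × Fin N) : R :=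
  u e.1 * w e.2 - u e.2 * w e.1

/-- The minors of the generic `2 × N` matrix. -/
noncomputable def genericMinor (K : Type*) [Field K] (N : ℕ) :
    Fin N × Fin N → MvPolynomial (Fin N ⊕ Fin N) K :=
  pluckerVec (fun i => X (Sum.inl i)) fun i => X (Sum.inr i)

variable {K : Type*} [Field K] {N : ℕ}

theorem aeval_genericMinor (u w : Fin N → K) (e : Fin N × Fin N) :
    aeval (Sum.elim u w) (genericMinor K N e) = pluckerVec u w e := by
  simp [genericMinor, pluckerVec]

theorem aeval_pluckerVec_eq_zero {h : MvPolynomial (Fin N × Fin N) K}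
    (hh : aeval (genericMinor K N) h = 0) (u w : Fin N → K) : aeval (pluckerVec u w) h = 0 := by
  have := congrArg (aeval (Sum.elim u w)) hh
  rw [← AlgHom.comp_apply, comp_aeval, map_zero] at this
  simpa only [aeval_genericMinor] using this

theorem isHomogeneous_genericMinor (e : Fin N × Fin N) : (genericMinor K N e).IsHomogeneous 2 :=
  ((isHomogeneous_X K _).mul (isHomogeneous_X K _)).sub
    ((isHomogeneous_X K _).mul (isHomogeneous_X K _))

theorem aeval_genericMinor_homogeneousComponent {h : MvPolynomial (Fin N × Fin N) K}
    (hh : aeval (genericMinor K N) h = 0) (k : ℕ) :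
    aeval (genericMinor K N) (homogeneousComponent k h) = 0 := by
  have hdeg : ∀ i, (aeval (genericMinor K N) (homogeneousComponent i h)).IsHomogeneous (2 * i) :=
    fun i => (homogeneousComponent_isHomogeneous i h).aeval _ isHomogeneous_genericMinor
  have hsum := congrArg (homogeneousComponent (2 * k)) hh
  rw [← sum_homogeneousComponent h, map_sum, map_sum, map_zero] at hsum
  have hterm : ∀ i, homogeneousComponent (2 * k)
      (aeval (genericMinor K N) (homogeneousComponent i h)) =
        if i = k then aeval (genericMinor K N) (homogeneousComponent k h) else 0 := by
    intro i
    rw [homogeneousComponent_of_mem (hdeg i)]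
    rcases eq_or_ne i k with rfl | hik
    · simp
    · rw [if_neg (by omega), if_neg hik]
  simp only [hterm, Finset.sum_ite_eq', Finset.mem_range] at hsum
  by_cases hk : k < h.totalDegree + 1
  · rwa [if_pos hk] at hsum
  · rw [homogeneousComponent_eq_zero k h (by omega), map_zero]

theorem algebraicIndependent_genericMinor [Infinite K] {m : ℕ} :
    AlgebraicIndependent K fun o : Option (Fin m ⊕ Fin m) => genericMinor K (m + 2)
      (o.elim (0, 1) (Sum.elim (fun j => (0, j.succ.succ)) fun j => (1, j.succ.succ))) := by
  rw [algebraicIndependent_iff]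
  intro q hq
  suffices X none * q = 0 from (mul_eq_zero.1 this).resolve_left (X_ne_zero none)
  refine MvPolynomial.funext fun z => ?_
  rw [map_mul, eval_X, map_zero, mul_eq_zero, or_iff_not_imp_left]
  intro hz
  let u : Fin (m + 2) → K := Fin.cons (z none) (Fin.cons 0 fun j => -z (some (Sum.inr j)))
  let w : Fin (m + 2) → K := Fin.cons 0 (Fin.cons 1 fun j => z (some (Sum.inl j)) / z none)
  have hu1 : u 1 = 0 := rfl
  have hw1 : w 1 = 1 := rfl
  have huw : (fun o : Option (Fin m ⊕ Fin m) => pluckerVec u w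
      (o.elim (0, 1) (Sum.elim (fun j => (0, j.succ.succ)) fun j => (1, j.succ.succ)))) = z := by
    ext o
    rcases o with _ | j | j
    · simp [pluckerVec, u, hu1, hw1]
    · simp [pluckerVec, u, w, mul_div_cancel₀, hz]
    · simp [pluckerVec, u, w, hu1, hw1]
  have := congrArg (aeval (Sum.elim u w)) hq
  rw [← AlgHom.comp_apply, comp_aeval, map_zero] at this
  simp only [aeval_genericMinor, huw] at this
  exact this

theorem exists_eq_pluckerVec {x : Fin N × Fin N → K} (hx : x ≠ 0)
    (hanti : ∀ i j, x (j, i) = -x (i, j))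
    (hrel : ∀ i j k l, x (i, l) * x (j, k) = x (i, k) * x (j, l) - x (i, j) * x (k, l)) :
    ∃ u w, x = pluckerVec u w := by
  obtain ⟨⟨a, b⟩, hab⟩ := Function.ne_iff.1 hx
  rw [Pi.zero_apply] at hab
  refine ⟨fun j => x (a, j), fun k => x (b, k) / x (a, b), ?_⟩
  ext ⟨j, k⟩
  have := hrel a j k b
  rw [hanti b j, hanti b k] at this
  simp only [pluckerVec]
  field_simp
  linear_combination this

theorem span_pair_le_of_pluckerVec_eq_smul {u w u' w' : Fin N → K} {c : K}
    (h : pluckerVec u' w' = c • pluckerVec u w) (h0 : pluckerVec u' w' ≠ 0) :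
    Submodule.span K {u', w'} ≤ Submodule.span K {u, w} := by
  obtain ⟨⟨a, b⟩, hab⟩ := Function.ne_iff.1 h0
  have hab : u' a * w' b - u' b * w' a ≠ 0 := hab
  have hc : ∀ i j, u' i * w' j - u' j * w' i = c * (u i * w j - u j * w i) :=
    fun i j => congrFun h (i, j)
  rw [Submodule.span_le, Set.insert_subset_iff, Set.singleton_subset_iff]
  constructor
  · refine (Submodule.smul_mem_iff _ hab).1 (Submodule.mem_span_pair.2
      ⟨c * (u' a * w b - u' b * w a), c * (u' b * u a - u' a * u b), ?_⟩)
    ext i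
    simp only [Pi.add_apply, Pi.smul_apply, smul_eq_mul]
    linear_combination (-u' a) * hc i b + u' b * hc i a
  · refine (Submodule.smul_mem_iff _ hab).1 (Submodule.mem_span_pair.2
      ⟨c * (w' a * w b - w' b * w a), c * (w' b * u a - w' a * u b), ?_⟩)
    ext i
    simp only [Pi.add_apply, Pi.smul_apply, smul_eq_mul]
    linear_combination (-w' a) * hc i b + w' b * hc i a

theorem span_pair_eq_of_pluckerVec_eq_smul {u w u' w' : Fin N → K} {c : K}
    (h : pluckerVec u' w' = c • pluckerVec u w) (h0 : pluckerVec u' w' ≠ 0) :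
    Submodule.span K {u', w'} = Submodule.span K {u, w} := by
  have hc : c ≠ 0 := by rintro rfl; simp [h] at h0
  have h' : pluckerVec u w = c⁻¹ • pluckerVec u' w' := by rw [h, inv_smul_smul₀ hc]
  refine le_antisymm (span_pair_le_of_pluckerVec_eq_smul h h0)
    (span_pair_le_of_pluckerVec_eq_smul h' ?_)
  rw [h']
  exact smul_ne_zero (inv_ne_zero hc) h0

theorem exists_pluckerVec_eq_smul {u w u' w' : Fin N → K}
    (h : Submodule.span K {u', w'} = Submodule.span K {u, w}) :
    ∃ c : K, pluckerVec u' w' = c • pluckerVec u w := by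
  obtain ⟨α, β, rfl⟩ := Submodule.mem_span_pair.1 (h ▸ Submodule.subset_span (by simp) :
    u' ∈ Submodule.span K {u, w})
  obtain ⟨γ, δ, rfl⟩ := Submodule.mem_span_pair.1 (h ▸ Submodule.subset_span (by simp) :
    w' ∈ Submodule.span K {u, w})
  refine ⟨α * δ - β * γ, ?_⟩
  ext e
  simp only [pluckerVec, Pi.add_apply, Pi.smul_apply, smul_eq_mul]
  ring

theorem finrank_span_pair_eq_two_iff {u w : Fin N → K} :
    Module.finrank K (Submodule.span K {u, w}) = 2 ↔ pluckerVec u w ≠ 0 := by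
  have : LinearIndependent K ![u, w] ↔ Module.finrank K (Submodule.span K {u, w}) = 2 := by
    rw [linearIndependent_iff_card_eq_finrank_span, Set.finrank, Matrix.range_cons_cons_empty,
      Fintype.card_fin, eq_comm]
  rw [← this, LinearIndependent.pair_iff]
  constructor
  · intro h h0
    have hu : u = 0 := by
      ext a
      refine (h (-w a) (u a) ?_).2
      ext b
      simpa [pluckerVec, sub_eq_neg_add, mul_comm] using congrFun h0 (a, b)
    simpa using (h 1 0 (by simp [hu])).1
  · intro h s t hst
    obtain ⟨⟨a, b⟩, hab⟩ := Function.ne_iff.1 h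
    have hab : u a * w b - u b * w a ≠ 0 := hab
    have ha : s * u a + t * w a = 0 := congrFun hst a
    have hb : s * u b + t * w b = 0 := congrFun hst b
    constructor
    · refine (mul_eq_zero.1 (?_ : s * (u a * w b - u b * w a) = 0)).resolve_right hab
      linear_combination w b * ha - w a * hb
    · refine (mul_eq_zero.1 (?_ : t * (u a * w b - u b * w a) = 0)).resolve_right hab
      linear_combination u a * hb - u b * ha

/-- The quadratic form in the Plücker coordinates which vanishes at the lines tangent to `B`. -/
noncomputable def tangencyForm (B : LinearMap.BilinForm K (Fin N → K)) : MvPolynomial (Fin N × Fin N) K :=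
  ∑ a : Fin N × Fin N, ∑ b : Fin N × Fin N,
    C (B (Pi.single a.1 1) (Pi.single a.2 1) * B (Pi.single b.1 1) (Pi.single b.2 1)) *
      (X (a.1, b.1) * X (a.2, b.2))

theorem isHomogeneous_tangencyForm (B : LinearMap.BilinForm K (Fin N → K)) :
    (tangencyForm B).IsHomogeneous 2 :=
  IsHomogeneous.sum _ _ _ fun _ _ => IsHomogeneous.sum _ _ _ fun _ _ =>
    ((isHomogeneous_X K _).mul (isHomogeneous_X K _)).C_mul _

theorem aeval_tangencyForm (B : LinearMap.BilinForm K (Fin N → K)) (u w : Fin N → K) :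
    aeval (pluckerVec u w) (tangencyForm B) = 2 * (B u u * B w w - B u w * B w u) := by
  have hB : ∀ x y : Fin N → K, B x y =
      ∑ a : Fin N × Fin N, B (Pi.single a.1 1) (Pi.single a.2 1) * (x a.1 * y a.2) := by
    intro x y
    conv_lhs => rw [pi_eq_sum_univ' x, pi_eq_sum_univ' y]
    simp only [map_sum, map_smul, LinearMap.sum_apply, LinearMap.smul_apply, smul_eq_mul,
      Fintype.sum_prod_type, Finset.mul_sum]
    rw [Finset.sum_comm]
    refine Finset.sum_congr rfl fun i _ => Finset.sum_congr rfl fun j _ => by ring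
  have hsplit : 2 * (B u u * B w w - B u w * B w u) =
      B u u * B w w - B u w * B w u - B w u * B u w + B w w * B u u := by ring
  rw [hsplit, hB u u, hB u w, hB w u, hB w w]
  simp only [Finset.sum_mul_sum, ← Finset.sum_sub_distrib, ← Finset.sum_add_distrib, tangencyForm,
    map_sum, map_mul, aeval_X, aeval_C, Algebra.algebraMap_self, RingHom.id_apply, pluckerVec]
  refine Finset.sum_congr rfl fun a _ => Finset.sum_congr rfl fun b _ => by ring

end GenericMinors

section CommonTangents

open MvPolynomial

theorem ncard_common_tangents_le {K : Type*} [Field K] [IsAlgClosed K] [NeZero (2 : K)] {m : ℕ}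
    (B : Fin (2 * m) → LinearMap.BilinForm K (Fin (m + 2) → K)) (hsymm : ∀ i x y, B i x y = B i y x)
    {L : Set (Submodule K (Fin (m + 2) → K))} (hfin : L.Finite)
    (hmem : ∀ u w, Submodule.span K {u, w} ∈ L ↔ pluckerVec u w ≠ 0 ∧
      ∀ i, B i u u * B i w w = B i u w ^ 2)
    (hbasis : ∀ W ∈ L, ∃ u w, Submodule.span K {u, w} = W) :
    L.ncard ≤ 2 ^ (2 * m) * catalan m := by
  have := hfin.fintype
  rw [← Nat.card_coe_set_eq, Nat.card_eq_fintype_card]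
  have hbasis' : ∀ W : L, ∃ u w, Submodule.span K {u, w} = (W : Submodule K (Fin (m + 2) → K)) :=
    fun W => hbasis W W.2
  choose u w huw using hbasis'
  have hW : ∀ W, pluckerVec (u W) (w W) ≠ 0 ∧
      ∀ i, B i (u W) (u W) * B i (w W) (w W) = B i (u W) (w W) ^ 2 :=
    fun W => (hmem _ _).1 (by rw [huw]; exact W.2)
  let φ := (aeval (R := K) (genericMinor K (m + 2))).rangeRestrict
  have hφ : ∀ h, φ h = 0 ↔ aeval (genericMinor K (m + 2)) h = 0 := fun h => by
    rw [Subtype.ext_iff]; rfl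
  have hφ_eq : ∀ {p q}, aeval (genericMinor K (m + 2)) p = aeval (genericMinor K (m + 2)) q →
      φ p = φ q := fun h => Subtype.ext h
  let y : Option (Fin m ⊕ Fin m) → (aeval (R := K) (genericMinor K (m + 2))).range := fun o =>
    φ (X (o.elim (0, 1) (Sum.elim (fun j => (0, j.succ.succ)) fun j => (1, j.succ.succ))))
  have hy : AlgebraicIndependent K y := by
    refine AlgebraicIndependent.of_comp (Subalgebra.val _) ?_
    convert algebraicIndependent_genericMinor (K := K) (m := m) using 1
    ext1 o
    exact aeval_X _ _
  let σ := (((finCongr (two_mul m)).trans finSumFinEquiv.symm).optionCongr)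
  have htan : ∀ i u w, aeval (pluckerVec u w) (tangencyForm (B i)) = 0 ↔
      B i u u * B i w w = B i u w ^ 2 := fun i u w => by
    rw [aeval_tangencyForm, hsymm i w u, mul_eq_zero_iff_left (NeZero.ne _), sub_eq_zero, sq]
  refine card_le_two_pow_mul_of_finrank_le φ (AlgHom.rangeRestrict_surjective _)
    (fun h hh k => ?_) (hy.comp σ σ.injective) (fun k => ?_) (fun i => tangencyForm (B i))
    (fun i => isHomogeneous_tangencyForm _) (fun W => pluckerVec (u W) (w W)) (fun W => (hW W).1)
    (fun W W' c h => ?_) (fun W h hh => aeval_pluckerVec_eq_zero ((hφ h).1 hh) _ _)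
    (fun W i => (htan i _ _).2 ((hW W).2 i)) fun x hx hker hF => ?_
  · exact (hφ _).2 (aeval_genericMinor_homogeneousComponent ((hφ h).1 hh) k)
  · have hφ' : φ = aeval fun e => φ (X e) := (aeval_unique φ)
    rw [hφ']
    refine finrank_map_homogeneousSubmodule_le _ (fun i => ?_) (fun i j => ?_) (fun i j k l => ?_) k
    · exact (hφ _).2 (by simp [genericMinor, pluckerVec])
    · rw [← map_neg]
      exact hφ_eq (by simp [genericMinor, pluckerVec])
    · simp only [← map_mul, ← map_sub]
      exact hφ_eq (by simp only [map_sub, map_mul, aeval_X, genericMinor, pluckerVec]; ring)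
  · rw [Subtype.ext_iff, ← huw W, ← huw W']
    exact span_pair_eq_of_pluckerVec_eq_smul h (hW W).1
  · obtain ⟨u₀, w₀, rfl⟩ : ∃ u w, x = pluckerVec u w := by
      refine exists_eq_pluckerVec hx (fun i j => ?_) fun i j k l => ?_
      · have := hker (X (j, i) + X (i, j)) ((hφ _).2 (by simp [genericMinor, pluckerVec]))
        simpa [add_eq_zero_iff_eq_neg] using this
      · have := hker (X (i, l) * X (j, k) - (X (i, k) * X (j, l) - X (i, j) * X (k, l)))
          ((hφ _).2 (by simp only [map_sub, map_mul, aeval_X, genericMinor, pluckerVec]; ring))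
        simpa [sub_eq_zero] using this
    have hL := (hmem u₀ w₀).2 ⟨hx, fun i => (htan i _ _).1 (hF i)⟩
    exact ⟨⟨_, hL⟩, exists_pluckerVec_eq_smul (huw ⟨_, hL⟩).symm⟩

end CommonTangents

/-- there are at most `2^{2n−2}·C_{n−1}` isolated common tangent lines to
`2n−2` quadric hypersurfaces in `ℙⁿ_ℂ`, where `C_{n−1} = (1/n)·binom(2n−2,n−1)` is the
`(n−1)`-st Catalan number. Lines in `ℙⁿ_ℂ` are two-dimensional linear subspaces
`W ⊆ ℂ^{n+1}`, and `W` is tangent to the quadric defined by a symmetric bilinear form `B`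
when `B(u,u)·B(w,w) = B(u,w)²` for a basis (i.e. a spanning pair) `u, w` of `W`. -/
theorem tangents_to_quadrics_le (n : ℕ) (hn : 2 ≤ n)
    (B : Fin (2 * n - 2) → LinearMap.BilinForm ℂ (Fin (n + 1) → ℂ))
    (hsymm : ∀ i x y, B i x y = B i y x) :
    (({W | Module.finrank ℂ W = 2 ∧
        ∀ i, ∃ u w : Fin (n + 1) → ℂ, Submodule.span ℂ {u, w} = W ∧
          B i u u * B i w w = (B i u w) ^ 2} :
        Set (Submodule ℂ (Fin (n + 1) → ℂ))).Finite) →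
      (({W | Module.finrank ℂ W = 2 ∧
        ∀ i, ∃ u w : Fin (n + 1) → ℂ, Submodule.span ℂ {u, w} = W ∧
          B i u u * B i w w = (B i u w) ^ 2} :
        Set (Submodule ℂ (Fin (n + 1) → ℂ))).ncard ≤ 2 ^ (2 * n - 2) * catalan (n - 1)) := by
  obtain ⟨m, rfl⟩ : ∃ m, n = m + 1 := ⟨n - 1, by omega⟩
  rw [show m + 1 - 1 = m from rfl]
  intro hfin
  refine ncard_common_tangents_le (K := ℂ) B hsymm hfin (fun u w => ?_) ?_
  · rw [Set.mem_ofPred_eq, finrank_span_pair_eq_two_iff]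
    refine and_congr_right fun h0 => forall_congr' fun i => ⟨?_, fun h => ⟨u, w, rfl, h⟩⟩
    rintro ⟨u', w', hspan, h⟩
    obtain ⟨c, hc⟩ := exists_pluckerVec_eq_smul hspan.symm
    have h' := aeval_tangencyForm (B i) u w
    rw [hc, MvPolynomial.aeval_smul_of_isHomogeneous (isHomogeneous_tangencyForm _),
      aeval_tangencyForm, hsymm i w' u', hsymm i w u] at h'
    linear_combination (-1 / 2) * h' + c ^ 2 * h
  · rintro W ⟨-, h⟩
    obtain ⟨u, w, hspan, -⟩ := h ⟨0, by omega⟩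
    exact ⟨u, w, hspan⟩
end
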